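/- There exists a set R_A ⊆ [0,1] of irrational numbers whose complement in [0,1] has Lebesgue measure zero with the following property: for every C³ orientation-preserving circle homeomorphism f with exactly one critical point (non-flat) and ρ(f)∈R_A, every equivalence class of the relation ∼_f on S¹ is meagre in S¹; in particular, the set of equivalence classes S¹/∼_f is uncountable. Here x∼_f y if and only if there exists a quasisymmetric circle homeomorphism h with h∘f=f∘h and h(x)=y. -/

import Mathlib

noncomputable section

open Set Filter MeasureTheory Topology

/-- The circle `ℝ/ℤ`. -/
abbrev S1 := AddCircle (1 : ℝ)

/-- `F` is an (orientation-preserving) lift of the circle map `f`. -/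
def IsLift (f : S1 → S1) (F : ℝ → ℝ) : Prop :=
  StrictMono F ∧ Function.Surjective F ∧ (∀ x : ℝ, F (x + 1) = F x + 1) ∧
    ∀ x : ℝ, f (x : S1) = (F x : S1)

/-- `f` is an orientation-preserving circle homeomorphism. -/
def IsCircleHomeo (f : S1 → S1) : Prop := ∃ F : ℝ → ℝ, IsLift f F

/-- `f` has rotation number `ρ ∈ [0,1)`: some lift of `f` has translation number `ρ`. -/
def HasRotNum (f : S1 → S1) (ρ : ℝ) : Prop :=
  ∃ F : ℝ → ℝ, IsLift f F ∧ Tendsto (fun n : ℕ => F^[n] 0 / (n : ℝ)) atTop (𝓝 ρ)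

/-- The lift `F` has a non-flat (power-law) critical point at `c`:
on a neighbourhood `W` of `c`, `F y = F c + φ(y)|φ(y)|^(d-1)` for a `C³` diffeomorphism `φ`
with `φ c = 0`. -/
def NonFlatAt (F : ℝ → ℝ) (c : ℝ) : Prop :=
  ∃ d : ℝ, 1 < d ∧ ∃ W : Set ℝ, IsOpen W ∧ c ∈ W ∧ ∃ φ : ℝ → ℝ,
    ContDiffOn ℝ 3 φ W ∧ InjOn φ W ∧ (∀ y ∈ W, deriv φ y ≠ 0) ∧ φ c = 0 ∧
    ∀ y ∈ W, F y = F c + φ y * |φ y| ^ (d - 1)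

/-- `f` is a `C^k` unicritical circle map: an orientation-preserving `C^k` circle
homeomorphism whose only critical point is `c`, and it is non-flat. -/
def Unicritical (f : S1 → S1) (c : S1) (k : ℕ∞) : Prop :=
  ∃ (F : ℝ → ℝ) (x₀ : ℝ), IsLift f F ∧ ContDiff ℝ k F ∧ (x₀ : S1) = c ∧
    {x : ℝ | deriv F x = 0} = {x : ℝ | ∃ m : ℤ, x = x₀ + m} ∧ NonFlatAt F x₀

/-- `f` is a `C^k` bi-critical circle map: an orientation-preserving `C^k` circle
homeomorphism with exactly two critical points `c₁ ≠ c₂`, both non-flat. -/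
def Bicritical (f : S1 → S1) (c₁ c₂ : S1) (k : ℕ∞) : Prop :=
  c₁ ≠ c₂ ∧ ∃ (F : ℝ → ℝ) (x₁ x₂ : ℝ), IsLift f F ∧ ContDiff ℝ k F ∧
    (x₁ : S1) = c₁ ∧ (x₂ : S1) = c₂ ∧
    {x : ℝ | deriv F x = 0} =
      {x : ℝ | ∃ m : ℤ, x = x₁ + m} ∪ {x : ℝ | ∃ m : ℤ, x = x₂ + m} ∧
    NonFlatAt F x₁ ∧ NonFlatAt F x₂

/-- `h` is a quasisymmetric (orientation-preserving) circle homeomorphism. -/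
def QuasiSymm (h : S1 → S1) : Prop :=
  ∃ H : ℝ → ℝ, IsLift h H ∧ ∃ M : ℝ, 1 < M ∧ ∀ x t : ℝ, 0 < t →
    1 / M ≤ (H (x + t) - H x) / (H x - H (x - t)) ∧
      (H (x + t) - H x) / (H x - H (x - t)) ≤ M

/-- The length (in `[0,1)`) of the positively oriented arc from `x` to `y`. -/
def arcLen (x y : S1) : ℝ := (AddCircle.equivIco 1 0 (y - x) : ℝ)

/-- The positively oriented open arc from `x` to `y` on the circle. -/
def posArc (x y : S1) : Set S1 := (fun t : ℝ => x + (t : S1)) '' Ioo 0 (arcLen x y)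

/-! ### Cross-ratios and their distortion -/

/-- The cross-ratio `|L||R| / (|L ∪ M||M ∪ R|)` of `L = [a,b]`, `M = [b,c]`, `R = [c,d]`. -/
def crossRatio (a b c d : ℝ) : ℝ := (b - a) * (d - c) / ((c - a) * (d - b))

theorem crossRatio_pos {a b c d : ℝ} (hab : a < b) (hbc : b < c) (hcd : c < d) :
    0 < crossRatio a b c d := by
  unfold crossRatio
  have := sub_pos.2 hab
  have := sub_pos.2 hcd
  have := sub_pos.2 (hab.trans hbc)
  have := sub_pos.2 (hbc.trans hcd)
  positivity

theorem crossRatio_neg (a b c d : ℝ) :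
    crossRatio (-d) (-c) (-b) (-a) = crossRatio a b c d := by
  unfold crossRatio
  congr 1 <;> ring

theorem crossRatio_add_const (a b c d k : ℝ) :
    crossRatio (a + k) (b + k) (c + k) (d + k) = crossRatio a b c d := by
  unfold crossRatio
  congr 1 <;> ring

theorem crossRatio_le_left {a b c d : ℝ} (hab : a < b) (hbc : b < c) (hcd : c < d) :
    crossRatio a b c d ≤ (b - a) / (c - a) := by
  unfold crossRatio
  have h1 := sub_pos.2 hab
  have h2 := sub_pos.2 (hab.trans hbc)
  have h3 := sub_pos.2 (hbc.trans hcd)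
  rw [div_le_div_iff₀ (by positivity) h2]
  have : (d - c) ≤ d - b := by linarith
  nlinarith [mul_nonneg (mul_nonneg h1.le h2.le) (sub_nonneg.2 this)]

theorem sub_le_mul_of_hasDerivAt_le {f f' : ℝ → ℝ} {x y C : ℝ} (hxy : x ≤ y)
    (hf : ∀ t ∈ Icc x y, HasDerivAt f (f' t) t) (hC : ∀ t ∈ Icc x y, f' t ≤ C) :
    f y - f x ≤ C * (y - x) := by
  refine (convex_Icc x y).image_sub_le_mul_sub_of_deriv_le
    (fun t ht => (hf t ht).continuousAt.continuousWithinAt)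
    (fun t ht => (hf t (interior_subset ht)).differentiableAt.differentiableWithinAt)
    (fun t ht => ?_) x (left_mem_Icc.2 hxy) y (right_mem_Icc.2 hxy) hxy
  rw [(hf t (interior_subset ht)).deriv]
  exact hC t (interior_subset ht)

theorem mul_le_sub_of_le_hasDerivAt {f f' : ℝ → ℝ} {x y C : ℝ} (hxy : x ≤ y)
    (hf : ∀ t ∈ Icc x y, HasDerivAt f (f' t) t) (hC : ∀ t ∈ Icc x y, C ≤ f' t) :
    C * (y - x) ≤ f y - f x := by
  have := sub_le_mul_of_hasDerivAt_le (f := fun t => -f t) (f' := fun t => -f' t) (C := -C) hxy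
    (fun t ht => (hf t ht).neg) (fun t ht => neg_le_neg (hC t ht))
  linarith

theorem strictMonoOn_of_hasDerivAt_pos {f f' : ℝ → ℝ} {a b : ℝ}
    (hf : ∀ t ∈ Icc a b, HasDerivAt f (f' t) t) (hpos : ∀ t ∈ Icc a b, 0 < f' t) :
    StrictMonoOn f (Icc a b) := by
  refine strictMonoOn_of_deriv_pos (convex_Icc a b)
    (fun t ht => (hf t ht).continuousAt.continuousWithinAt) (fun t ht => ?_)
  rw [(hf t (interior_subset ht)).deriv]
  exact hpos t (interior_subset ht)

/-- If `G` satisfies a two-point inequality of Schwarzian type, then it increases cross-ratios by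
at most a factor `1 + K |T|²`. -/
theorem crossRatio_comp_le {G g : ℝ → ℝ} {a b c d K : ℝ} (hab : a < b) (hbc : b < c) (hcd : c < d)
    (hK : 0 ≤ K) (hG : ∀ x ∈ Icc a d, HasDerivAt G (g x) x) (hg : ∀ x ∈ Icc a d, 0 < g x)
    (hS : ∀ x ∈ Icc a d, ∀ y ∈ Icc a d, x < y →
      g x * g y * (y - x) ^ 2 ≤ (G y - G x) ^ 2 * (1 + K * (y - x) ^ 2)) :
    crossRatio (G a) (G b) (G c) (G d) ≤ (1 + K * (d - a) ^ 2) * crossRatio a b c d := by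
  have hmono := strictMonoOn_of_hasDerivAt_pos hG hg
  have hlt : ∀ x ∈ Icc a d, ∀ y ∈ Icc a d, x < y → 0 < G y - G x :=
    fun x hx y hy h => sub_pos.2 (hmono hx hy h)
  have ma : a ∈ Icc a d := ⟨le_rfl, by linarith⟩
  have mb : b ∈ Icc a d := ⟨by linarith, by linarith⟩
  have mc : c ∈ Icc a d := ⟨by linarith, by linarith⟩
  have md : d ∈ Icc a d := ⟨by linarith, le_rfl⟩
  -- integrate the mixed second derivative of `log ((G y - G x) / (y - x))` in `y`
  have hP : ∀ x ∈ Icc a b, (-(g x / (G d - G x)) + 1 / (d - x)) -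
      (-(g x / (G c - G x)) + 1 / (c - x)) ≤ K * (d - c) := by
    intro x hx
    have mx : x ∈ Icc a d := ⟨hx.1, by linarith [hx.2]⟩
    refine sub_le_mul_of_hasDerivAt_le (f := fun y => -(g x / (G y - G x)) + 1 / (y - x))
      (f' := fun y => g x * g y / (G y - G x) ^ 2 - 1 / (y - x) ^ 2) hcd.le ?_ ?_
    · intro y hy
      have my : y ∈ Icc a d := ⟨by linarith [hy.1], hy.2⟩
      have hxy : x < y := by linarith [hx.2, hy.1]
      have h1 : G y - G x ≠ 0 := (hlt x mx y my hxy).ne'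
      have h2 : y - x ≠ 0 := (sub_pos.2 hxy).ne'
      have d1 : HasDerivAt (fun y => G y - G x) (g y) y := (hG y my).sub_const _
      have d2 : HasDerivAt (fun y : ℝ => y - x) 1 y := (hasDerivAt_id y).sub_const _
      have e1 := ((hasDerivAt_const y (g x)).div d1 h1).neg
      have e2 := (hasDerivAt_const y (1 : ℝ)).div d2 h2
      refine (e1.add e2).congr_deriv ?_
      field_simp
      ring
    · intro y hy
      have my : y ∈ Icc a d := ⟨by linarith [hy.1], hy.2⟩
      have hxy : x < y := by linarith [hx.2, hy.1]
      have h1 := hlt x mx y my hxy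
      have h2 := sub_pos.2 hxy
      rw [sub_le_iff_le_add, div_le_iff₀ (by positivity)]
      have := hS x mx y my hxy
      have e : (K + 1 / (y - x) ^ 2) * (G y - G x) ^ 2 =
          (G y - G x) ^ 2 * (1 + K * (y - x) ^ 2) / (y - x) ^ 2 := by
        field_simp
        ring
      rw [e, le_div_iff₀ (by positivity)]
      exact this
  -- and then in `x`
  have hH : (Real.log (G d - G b) - Real.log (d - b) - (Real.log (G c - G b) - Real.log (c - b))) -
      (Real.log (G d - G a) - Real.log (d - a) - (Real.log (G c - G a) - Real.log (c - a))) ≤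
      K * (d - c) * (b - a) := by
    refine sub_le_mul_of_hasDerivAt_le
      (f := fun x => Real.log (G d - G x) - Real.log (d - x) -
        (Real.log (G c - G x) - Real.log (c - x)))
      (f' := fun x => (-(g x / (G d - G x)) + 1 / (d - x)) -
        (-(g x / (G c - G x)) + 1 / (c - x))) hab.le ?_ hP
    intro x hx
    have mx : x ∈ Icc a d := ⟨hx.1, by linarith [hx.2]⟩
    have h1 : G d - G x ≠ 0 := (hlt x mx d md (by linarith [hx.2])).ne'
    have h2 : G c - G x ≠ 0 := (hlt x mx c mc (by linarith [hx.2])).ne'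
    have h3 : d - x ≠ 0 := by linarith [hx.2]
    have h4 : c - x ≠ 0 := by linarith [hx.2]
    have d1 := ((hG x mx).const_sub (G d)).log h1
    have d2 := ((hG x mx).const_sub (G c)).log h2
    have d3 := ((hasDerivAt_id x).const_sub d).log h3
    have d4 := ((hasDerivAt_id x).const_sub c).log h4
    refine ((d1.sub d3).sub (d2.sub d4)).congr_deriv ?_
    simp only [id]
    ring
  have p1 := hlt a ma b mb hab
  have p2 := hlt b mb c mc hbc
  have p3 := hlt c mc d md hcd
  have q1 := sub_pos.2 hab
  have q2 := sub_pos.2 hbc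
  have q3 := sub_pos.2 hcd
  have r1 : 0 < G c - G a := by linarith
  have r2 : 0 < G d - G b := by linarith
  have r3 : 0 < G d - G a := by linarith
  have s1 : 0 < c - a := by linarith
  have s2 : 0 < d - b := by linarith
  have s3 : 0 < d - a := by linarith
  set u := (c - b) * (d - a) / ((c - a) * (d - b)) with hu
  set u' := (G c - G b) * (G d - G a) / ((G c - G a) * (G d - G b)) with hu'
  have hupos : 0 < u := by positivity
  have hu'pos : 0 < u' := by positivity
  have hlog : Real.log u - Real.log u' ≤ K * (d - c) * (b - a) := by
    rw [hu, hu', Real.log_div (by positivity) (by positivity),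
      Real.log_div (by positivity) (by positivity), Real.log_mul p2.ne' r3.ne',
      Real.log_mul r1.ne' r2.ne', Real.log_mul q2.ne' s3.ne', Real.log_mul s1.ne' s2.ne']
    linarith
  have hcr : crossRatio a b c d = 1 - u := by
    rw [hu]; unfold crossRatio; field_simp; ring
  have hcr' : crossRatio (G a) (G b) (G c) (G d) = 1 - u' := by
    rw [hu']; unfold crossRatio; field_simp; ring
  have hu1 : u ≤ 1 := by
    have := crossRatio_pos hab hbc hcd
    linarith
  have hprod : (b - a) * (d - c) ≤ crossRatio a b c d * (d - a) ^ 2 := by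
    have e : (b - a) * (d - c) = crossRatio a b c d * ((c - a) * (d - b)) := by
      unfold crossRatio; field_simp
    rw [e]
    refine mul_le_mul_of_nonneg_left ?_ (crossRatio_pos hab hbc hcd).le
    rw [sq]
    exact mul_le_mul (by linarith) (by linarith) s2.le s3.le
  have hle : u * (1 - K * (d - c) * (b - a)) ≤ u' := by
    have h1 : u * Real.exp (-(K * (d - c) * (b - a))) ≤ u' := by
      rw [← Real.log_le_log_iff (by positivity) hu'pos, Real.log_mul hupos.ne'
        (Real.exp_pos _).ne', Real.log_exp]
      linarith
    refine le_trans (mul_le_mul_of_nonneg_left ?_ hupos.le) h1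
    linarith [Real.add_one_le_exp (-(K * (d - c) * (b - a)))]
  rw [hcr']
  have h0 : 0 ≤ K * (d - c) * (b - a) := by positivity
  have h2 : u * (K * (d - c) * (b - a)) ≤ K * (d - c) * (b - a) := by nlinarith
  have h3 : K * ((b - a) * (d - c)) ≤ K * (crossRatio a b c d * (d - a) ^ 2) :=
    mul_le_mul_of_nonneg_left hprod hK
  rw [hcr] at h3 ⊢
  nlinarith

/-- Trapezoid inequality with a lower bound for the remainder. -/
theorem trapezoid_le {G g g' : ℝ → ℝ} {x y K : ℝ} (hxy : x ≤ y)
    (hG : ∀ t ∈ Icc x y, HasDerivAt G (g t) t) (hg : ∀ t ∈ Icc x y, HasDerivAt g (g' t) t)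
    (hK : ∀ s ∈ Icc x y, ∀ t ∈ Icc x y, s ≤ t → g' t - g' s ≤ K * (t - s)) (hK0 : 0 ≤ K) :
    (g x + g y) / 2 * (y - x) - K * (y - x) ^ 3 ≤ G y - G x := by
  have key := mul_le_sub_of_le_hasDerivAt
    (f := fun t => G t - (g x + g t) / 2 * (t - x) + K * (t - x) ^ 3)
    (f' := fun t => g t - (g' t / 2 * (t - x) + (g x + g t) / 2 * 1) +
      K * ((3 : ℕ) * (t - x) ^ (3 - 1) * 1)) (C := 0) hxy ?_ ?_
  · simp only [sub_self] at key
    nlinarith [key]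
  · intro t ht
    have d1 := ((hg t ht).const_add (g x)).div_const 2
    have d2 : HasDerivAt (fun t : ℝ => t - x) 1 t := (hasDerivAt_id t).sub_const _
    exact ((hG t ht).sub (d1.mul d2)).add ((d2.pow 3).const_mul K)
  · intro t ht
    have h1 := mul_le_sub_of_le_hasDerivAt (f := g) (f' := g') (x := x) (y := t)
      (C := g' t - K * (t - x)) ht.1
      (fun s hs => hg s ⟨hs.1, hs.2.trans ht.2⟩) (fun s hs => by
        have := hK s ⟨hs.1, hs.2.trans ht.2⟩ t ht hs.2
        have h2 : K * (t - s) ≤ K * (t - x) := mul_le_mul_of_nonneg_left (by linarith [hs.1]) hK0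
        linarith)
    have : 0 ≤ K * (t - x) ^ 2 := by positivity
    push_cast
    norm_num
    nlinarith

/-- A `C³` diffeomorphism distorts cross-ratios by at most `1 + K |T|²` on a compact interval. -/
theorem exists_crossRatio_le_of_contDiffOn {G : ℝ → ℝ} {W : Set ℝ} {A B : ℝ} (hW : IsOpen W)
    (hAB : Icc A B ⊆ W) (hG : ContDiffOn ℝ 3 G W) (hpos : ∀ x ∈ Icc A B, 0 < deriv G x) :
    ∃ K : ℝ, 0 ≤ K ∧ ∀ a b c d : ℝ, A ≤ a → a < b → b < c → c < d → d ≤ B →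
      crossRatio (G a) (G b) (G c) (G d) ≤ (1 + K * (d - a) ^ 2) * crossRatio a b c d := by
  rcases lt_or_ge B A with hBA | hBA
  · exact ⟨0, le_rfl, fun a b c d h1 h2 h3 h4 h5 => by linarith⟩
  have c1 : ContDiffOn ℝ 2 (deriv G) W := hG.deriv_of_isOpen hW (by norm_num)
  have c2 : ContDiffOn ℝ 1 (deriv (deriv G)) W := c1.deriv_of_isOpen hW (by norm_num)
  have c3 : ContinuousOn (deriv (deriv (deriv G))) W :=
    c2.continuousOn_deriv_of_isOpen hW (by norm_num)
  have e1 : ∀ x ∈ W, HasDerivAt G (deriv G x) x := fun x hx =>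
    ((hG.differentiableOn (by norm_num)).differentiableAt (hW.mem_nhds hx)).hasDerivAt
  have e2 : ∀ x ∈ W, HasDerivAt (deriv G) (deriv (deriv G) x) x := fun x hx =>
    ((c1.differentiableOn (by norm_num)).differentiableAt (hW.mem_nhds hx)).hasDerivAt
  have e3 : ∀ x ∈ W, HasDerivAt (deriv (deriv G)) (deriv (deriv (deriv G)) x) x := fun x hx =>
    ((c2.differentiableOn (by norm_num)).differentiableAt (hW.mem_nhds hx)).hasDerivAt
  obtain ⟨C, hC⟩ := isCompact_Icc.bddAbove_image (c3.mono hAB)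
  obtain ⟨x₁, hx₁, hmin⟩ := isCompact_Icc.exists_isMinOn (nonempty_Icc.2 hBA)
    (c1.continuousOn.mono hAB)
  set m := deriv G x₁
  have hm : 0 < m := hpos x₁ hx₁
  set K₁ := max C 0
  have hK₁ : 0 ≤ K₁ := le_max_right _ _
  set κ := K₁ / m
  have hκ : 0 ≤ κ := by positivity
  refine ⟨2 * κ + κ ^ 2 * (B - A) ^ 2, by positivity, fun a b c d h1 h2 h3 h4 h5 => ?_⟩
  have hsub : Icc a d ⊆ Icc A B := Icc_subset_Icc h1 h5
  refine crossRatio_comp_le h2 h3 h4 (by positivity) (fun x hx => e1 x (hAB (hsub hx)))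
    (fun x hx => hpos x (hsub hx)) ?_
  intro x hx y hy hxy
  have hxyAB : Icc x y ⊆ Icc A B := Icc_subset_Icc (hsub hx).1 (hsub hy).2
  have htrap := trapezoid_le (G := G) (g := deriv G) (g' := deriv (deriv G)) (K := K₁) hxy.le
    (fun t ht => e1 t (hAB (hxyAB ht))) (fun t ht => e2 t (hAB (hxyAB ht)))
    (fun s hs t ht hst => sub_le_mul_of_hasDerivAt_le hst
      (fun r hr => e3 r (hAB (hxyAB ⟨hs.1.trans hr.1, hr.2.trans ht.2⟩)))
      (fun r hr => (hC (mem_image_of_mem _ (hxyAB ⟨hs.1.trans hr.1, hr.2.trans ht.2⟩))).trans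
        (le_max_left _ _))) hK₁
  have hlow := mul_le_sub_of_le_hasDerivAt (f := G) (C := m) hxy.le
    (fun t ht => e1 t (hAB (hxyAB ht))) (fun t ht => hmin (hxyAB ht))
  have gx := hpos x (hsub hx)
  have gy := hpos y (hsub hy)
  set p := deriv G x
  set q := deriv G y
  set D := G y - G x
  set Δ := y - x with hΔ
  have hΔ0 : 0 < Δ := sub_pos.2 hxy
  have hΔB : Δ ≤ B - A := by linarith [(hsub hx).1, (hsub hy).2]
  have hκm : K₁ = κ * m := by simp only [κ]; field_simp
  have step : (p + q) / 2 * Δ ≤ D * (1 + κ * Δ ^ 2) := by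
    have : K₁ * Δ ^ 3 ≤ D * (κ * Δ ^ 2) := by
      rw [hκm]
      have : κ * Δ ^ 2 * (m * Δ) ≤ κ * Δ ^ 2 * D := mul_le_mul_of_nonneg_left hlow (by positivity)
      linarith
    linarith
  have hsq : p * q * Δ ^ 2 ≤ ((p + q) / 2 * Δ) ^ 2 := by nlinarith [sq_nonneg ((p - q) * Δ)]
  have hsq2 : ((p + q) / 2 * Δ) ^ 2 ≤ (D * (1 + κ * Δ ^ 2)) ^ 2 :=
    pow_le_pow_left₀ (by positivity) step 2
  refine (hsq.trans hsq2).trans ?_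
  rw [mul_pow]
  refine mul_le_mul_of_nonneg_left ?_ (sq_nonneg D)
  have : Δ ^ 2 ≤ (B - A) ^ 2 := pow_le_pow_left₀ hΔ0.le hΔB 2
  have : κ ^ 2 * Δ ^ 2 * Δ ^ 2 ≤ κ ^ 2 * Δ ^ 2 * (B - A) ^ 2 :=
    mul_le_mul_of_nonneg_left this (by positivity)
  linarith

/-- Two-point Schwarzian inequality for power maps. -/
theorem rpow_sub_rpow_sq_ge {x y d : ℝ} (hx : 0 < x) (hxy : x < y) (hd : 1 ≤ d) :
    d * x ^ (d - 1) * (d * y ^ (d - 1)) * (y - x) ^ 2 ≤ (y ^ d - x ^ d) ^ 2 := by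
  have hy : 0 < y := hx.trans hxy
  set s := (Real.log y + Real.log x) / 2 with hs
  set τ := (Real.log y - Real.log x) / 2 with hτ
  have hτ0 : 0 ≤ τ := by
    have := Real.log_le_log hx hxy.le
    linarith
  have hyexp : y = Real.exp (s + τ) := by
    rw [show s + τ = Real.log y by rw [hs, hτ]; ring, Real.exp_log hy]
  have hxexp : x = Real.exp (s - τ) := by
    rw [show s - τ = Real.log x by rw [hs, hτ]; ring, Real.exp_log hx]
  have hsinh : d * Real.sinh τ ≤ Real.sinh (d * τ) := by
    have := mul_le_sub_of_le_hasDerivAt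
      (f := fun t => Real.sinh (d * t) - d * Real.sinh t)
      (f' := fun t => Real.cosh (d * t) * (d * 1) - d * Real.cosh t) (C := 0) hτ0
      (fun t _ => (((hasDerivAt_id t).const_mul d).sinh).sub ((Real.hasDerivAt_sinh t).const_mul d))
      (fun t ht => by
        have : Real.cosh t ≤ Real.cosh (d * t) := by
          rw [Real.cosh_le_cosh, abs_of_nonneg ht.1, abs_of_nonneg (mul_nonneg (by linarith) ht.1)]
          nlinarith [ht.1]
        nlinarith)
    simp only [mul_zero, Real.sinh_zero, sub_zero, zero_mul] at this
    linarith
  have hsinh0 : 0 ≤ Real.sinh τ := Real.sinh_nonneg_iff.2 hτ0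
  have e1 : y ^ d - x ^ d = 2 * Real.exp (d * s) * Real.sinh (d * τ) := by
    rw [hyexp, hxexp, ← Real.exp_mul, ← Real.exp_mul, Real.sinh_eq]
    have h1 : Real.exp ((s + τ) * d) = Real.exp (d * s) * Real.exp (d * τ) := by
      rw [← Real.exp_add]; ring_nf
    have h2 : Real.exp ((s - τ) * d) = Real.exp (d * s) * Real.exp (-(d * τ)) := by
      rw [← Real.exp_add]; ring_nf
    rw [h1, h2]; ring
  have e2 : y - x = 2 * Real.exp s * Real.sinh τ := by
    rw [hyexp, hxexp, Real.sinh_eq, sub_eq_add_neg s τ, Real.exp_add, Real.exp_add]; ring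
  have e3 : x ^ (d - 1) * y ^ (d - 1) * Real.exp s ^ 2 = Real.exp (d * s) ^ 2 := by
    rw [hyexp, hxexp, ← Real.exp_mul, ← Real.exp_mul, ← Real.exp_add, sq, sq, ← Real.exp_add,
      ← Real.exp_add, ← Real.exp_add]
    ring_nf
  calc d * x ^ (d - 1) * (d * y ^ (d - 1)) * (y - x) ^ 2
      = 4 * (x ^ (d - 1) * y ^ (d - 1) * Real.exp s ^ 2) * (d * Real.sinh τ) ^ 2 := by
        rw [e2]; ring
    _ = 4 * Real.exp (d * s) ^ 2 * (d * Real.sinh τ) ^ 2 := by rw [e3]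
    _ ≤ 4 * Real.exp (d * s) ^ 2 * Real.sinh (d * τ) ^ 2 := by
        refine mul_le_mul_of_nonneg_left (pow_le_pow_left₀ ?_ hsinh 2) (by positivity)
        exact mul_nonneg (by linarith) hsinh0
    _ = (y ^ d - x ^ d) ^ 2 := by rw [e1]; ring

/-- Power maps do not increase cross-ratios. -/
theorem crossRatio_rpow_le {a b c d p : ℝ} (ha : 0 < a) (hab : a < b) (hbc : b < c) (hcd : c < d)
    (hp : 1 ≤ p) : crossRatio (a ^ p) (b ^ p) (c ^ p) (d ^ p) ≤ crossRatio a b c d := by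
  have := crossRatio_comp_le (G := fun x => x ^ p) (g := fun x => p * x ^ (p - 1)) (K := 0)
    hab hbc hcd le_rfl
    (fun x hx => Real.hasDerivAt_rpow_const (Or.inl (ha.trans_le hx.1).ne'))
    (fun x hx => mul_pos (by linarith) (Real.rpow_pos_of_pos (ha.trans_le hx.1) _))
    (fun x hx y hy hxy => by
      simpa using rpow_sub_rpow_sq_ge (ha.trans_le hx.1) hxy hp)
  simpa using this

/-! ### One iterate of a unicritical lift -/

/-- `F` is the lift of a `C³` unicritical circle map with critical points `x₀ + ℤ`. -/
structure UnicriticalLift (F : ℝ → ℝ) (x₀ : ℝ) : Prop where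
  strictMono : StrictMono F
  map_add_one : ∀ x, F (x + 1) = F x + 1
  contDiff : ContDiff ℝ 3 F
  deriv_eq_zero_iff : ∀ x, deriv F x = 0 ↔ ∃ m : ℤ, x = x₀ + m
  nonFlat : NonFlatAt F x₀

theorem Function.Periodic.exists_forall_le_of_continuous {h : ℝ → ℝ} (hp : Function.Periodic h 1)
    (hc : Continuous h) : ∃ x₁, ∀ x, h x₁ ≤ h x := by
  obtain ⟨x₁, -, hx₁⟩ := isCompact_Icc.exists_isMinOn (nonempty_Icc.2 (zero_le_one (α := ℝ)))
    hc.continuousOn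
  refine ⟨x₁, fun x => ?_⟩
  have : h (Int.fract x) = h x := by
    have h₁ := hp.sub_int_mul_eq (n := ⌊x⌋) (x := x)
    rw [mul_one] at h₁
    exact h₁
  rw [← this]
  exact hx₁ ⟨Int.fract_nonneg x, (Int.fract_lt_one x).le⟩

theorem map_add_int_of_map_add_one {F : ℝ → ℝ} (hF : ∀ x, F (x + 1) = F x + 1) (x : ℝ) (k : ℤ) :
    F (x + k) = F x + k := by
  have hp : Function.Periodic (fun x => F x - x) 1 := fun x => by
    simp only [hF]; ring
  have := hp.int_mul k x
  simp only [mul_one] at this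
  linarith

theorem map_sub_int_of_map_add_one {F : ℝ → ℝ} (hF : ∀ x, F (x + 1) = F x + 1) (x : ℝ) (k : ℤ) :
    F (x - k) = F x - k := by
  have := map_add_int_of_map_add_one hF x (-k)
  push_cast at this
  simpa [sub_eq_add_neg] using this

/-- The odd power map `u ↦ u |u|^(d-1)`. -/
def oddPow (d u : ℝ) : ℝ := u * |u| ^ (d - 1)

theorem oddPow_of_nonneg {d u : ℝ} (hd : 1 < d) (hu : 0 ≤ u) : oddPow d u = u ^ d := by
  unfold oddPow
  rcases hu.eq_or_lt with rfl | hu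
  · rw [zero_mul, Real.zero_rpow (by linarith)]
  · rw [abs_of_pos hu, Real.rpow_sub_one hu.ne']
    field_simp

theorem oddPow_neg (d u : ℝ) : oddPow d (-u) = -oddPow d u := by
  unfold oddPow
  rw [abs_neg]
  ring

theorem rpow_sub_rpow_le {d s t R : ℝ} (hd : 1 < d) (hs : 0 ≤ s) (hst : s ≤ t) (htR : t ≤ R) :
    t ^ d - s ^ d ≤ d * R ^ (d - 1) * (t - s) :=
  sub_le_mul_of_hasDerivAt_le (f := fun x => x ^ d) (f' := fun x => d * x ^ (d - 1)) hst
    (fun x _ => Real.hasDerivAt_rpow_const (Or.inr hd.le))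
    (fun x hx => mul_le_mul_of_nonneg_left
      (Real.rpow_le_rpow (hs.trans hx.1) (hx.2.trans htR) (by linarith)) (by linarith))

theorem rpow_mul_sub_le {d u v : ℝ} (hd : 1 < d) (hu : 0 ≤ u) (huv : u ≤ v) :
    v ^ (d - 1) * (v - u) ≤ v ^ d - u ^ d := by
  have hv := hu.trans huv
  have e : ∀ w : ℝ, 0 ≤ w → w ^ d = w * w ^ (d - 1) := fun w hw => by
    rw [← oddPow_of_nonneg hd hw, oddPow, abs_of_nonneg hw]
  rw [e v hv, e u hu]
  have : u * u ^ (d - 1) ≤ u * v ^ (d - 1) :=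
    mul_le_mul_of_nonneg_left (Real.rpow_le_rpow hu huv (by linarith)) hu
  linarith

theorem oddPow_sub_le {d s t R : ℝ} (hd : 1 < d) (hst : s ≤ t) (hs : -R ≤ s) (ht : t ≤ R) :
    oddPow d t - oddPow d s ≤ d * R ^ (d - 1) * (t - s) := by
  rcases le_or_gt 0 s with h0 | h0
  · rw [oddPow_of_nonneg hd h0, oddPow_of_nonneg hd (h0.trans hst)]
    exact rpow_sub_rpow_le hd h0 hst ht
  have es : oddPow d s = -(-s) ^ d := by
    rw [← oddPow_of_nonneg hd (by linarith : 0 ≤ -s), oddPow_neg, neg_neg]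
  rcases le_or_gt 0 t with h1 | h1
  · rw [es, oddPow_of_nonneg hd h1]
    have a1 := rpow_sub_rpow_le hd le_rfl h1 ht
    have a2 := rpow_sub_rpow_le hd le_rfl (by linarith : 0 ≤ -s) (by linarith : -s ≤ R)
    rw [Real.zero_rpow (by linarith)] at a1 a2
    linarith
  · have et : oddPow d t = -(-t) ^ d := by
      rw [← oddPow_of_nonneg hd (by linarith : 0 ≤ -t), oddPow_neg, neg_neg]
    rw [es, et]
    have := rpow_sub_rpow_le hd (by linarith : 0 ≤ -t) (by linarith : -t ≤ -s)
      (by linarith : -s ≤ R)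
    linarith

theorem mul_sub_le_oddPow_sub {d u v : ℝ} (hd : 1 < d) (huv : u ≤ v) :
    max |u| |v| ^ (d - 1) * (v - u) / 2 ≤ oddPow d v - oddPow d u := by
  have hpow : 0 ≤ max |u| |v| ^ (d - 1) := Real.rpow_nonneg (le_max_of_le_left (abs_nonneg u)) _
  rcases le_or_gt 0 u with h0 | h0
  · have hv := h0.trans huv
    rw [oddPow_of_nonneg hd h0, oddPow_of_nonneg hd hv]
    rw [abs_of_nonneg h0, abs_of_nonneg hv, max_eq_right huv] at *
    have := rpow_mul_sub_le hd h0 huv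
    have : 0 ≤ v ^ (d - 1) * (v - u) := mul_nonneg hpow (by linarith)
    linarith
  have eu : oddPow d u = -(-u) ^ d := by
    rw [← oddPow_of_nonneg hd (by linarith : 0 ≤ -u), oddPow_neg, neg_neg]
  rcases le_or_gt 0 v with h1 | h1
  · rw [eu, oddPow_of_nonneg hd h1]
    have a1 := rpow_mul_sub_le hd le_rfl h1
    have a2 := rpow_mul_sub_le hd le_rfl (by linarith : 0 ≤ -u)
    rw [Real.zero_rpow (by linarith)] at a1 a2
    rw [abs_of_neg h0, abs_of_nonneg h1] at *
    have hpv : 0 ≤ v ^ d := Real.rpow_nonneg h1 _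
    have hpu : 0 ≤ (-u) ^ d := Real.rpow_nonneg (by linarith) _
    rcases le_total (-u) v with h2 | h2
    · rw [max_eq_right h2] at *
      nlinarith
    · rw [max_eq_left h2] at *
      nlinarith
  · have ev : oddPow d v = -(-v) ^ d := by
      rw [← oddPow_of_nonneg hd (by linarith : 0 ≤ -v), oddPow_neg, neg_neg]
    rw [eu, ev]
    have := rpow_mul_sub_le hd (by linarith : 0 ≤ -v) (by linarith : -v ≤ -u)
    rw [abs_of_neg h0, abs_of_neg h1, max_eq_left (by linarith)] at *
    have : 0 ≤ (-u) ^ (d - 1) * (v - u) := mul_nonneg hpow (by linarith)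
    linarith

theorem oddPow_strictMono {d : ℝ} (hd : 1 < d) : StrictMono (oddPow d) := by
  intro u v huv
  have h := mul_sub_le_oddPow_sub hd huv.le
  have hR : 0 < max |u| |v| := by
    rcases eq_or_ne u 0 with rfl | hu
    · exact lt_max_of_lt_right (abs_pos.2 huv.ne')
    · exact lt_max_of_lt_left (abs_pos.2 hu)
  have : 0 < max |u| |v| ^ (d - 1) * (v - u) :=
    mul_pos (Real.rpow_pos_of_pos hR _) (sub_pos.2 huv)
  linarith

/-- The average of the derivative of an odd power map over an interval controls its supremum. -/
theorem oddPow_sub_mul_le {d u s t v : ℝ} (hd : 1 < d) (hus : u ≤ s) (hst : s ≤ t) (htv : t ≤ v) :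
    (oddPow d t - oddPow d s) * (v - u) ≤ 2 * d * (t - s) * (oddPow d v - oddPow d u) := by
  have huv : u ≤ v := by linarith
  set R := max |u| |v|
  have hR1 : -R ≤ s := by linarith [neg_abs_le u, le_max_left |u| |v|]
  have hR2 : t ≤ R := by linarith [le_abs_self v, le_max_right |u| |v|]
  have h1 := oddPow_sub_le hd hst hR1 hR2
  have h2 := mul_sub_le_oddPow_sub hd huv
  have h3 := mul_le_mul_of_nonneg_right h1 (sub_nonneg.2 huv)
  have h4 : d * (t - s) * (R ^ (d - 1) * (v - u) / 2) ≤
      d * (t - s) * (oddPow d v - oddPow d u) :=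
    mul_le_mul_of_nonneg_left h2 (mul_nonneg (by linarith) (sub_nonneg.2 hst))
  linarith

namespace UnicriticalLift

variable {F : ℝ → ℝ} {x₀ : ℝ}

theorem hasDerivAt (hF : UnicriticalLift F x₀) (x : ℝ) : HasDerivAt F (deriv F x) x :=
  (hF.contDiff.differentiable (by norm_num) x).hasDerivAt

theorem continuous_deriv (hF : UnicriticalLift F x₀) : Continuous (deriv F) :=
  hF.contDiff.continuous_deriv (by norm_num)

theorem deriv_pos (hF : UnicriticalLift F x₀) {x : ℝ} (hx : ∀ m : ℤ, x ≠ x₀ + m) :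
    0 < deriv F x := by
  refine lt_of_le_of_ne hF.strictMono.monotone.deriv_nonneg fun h => ?_
  obtain ⟨m, hm⟩ := (hF.deriv_eq_zero_iff x).1 h.symm
  exact hx m hm

theorem deriv_pos_of_mem_Ioo (hF : UnicriticalLift F x₀) {x : ℝ} (hx : x ∈ Ioo x₀ (x₀ + 1)) :
    0 < deriv F x := by
  refine hF.deriv_pos fun m hm => ?_
  have h1 : (0 : ℝ) < m := by linarith [hx.1]
  have h2 : (m : ℝ) < 1 := by linarith [hx.2]
  have h3 : (0 : ℤ) < m := by exact_mod_cast h1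
  have h4 : m < (1 : ℤ) := by exact_mod_cast h2
  omega

theorem exists_deriv_le (hF : UnicriticalLift F x₀) : ∃ M : ℝ, ∀ x, deriv F x ≤ M := by
  have hp : Function.Periodic (fun x => -deriv F x) 1 := fun x => by
    have : (fun y => F (y + 1)) = fun y => F y + 1 := funext hF.map_add_one
    have h := congrArg (fun g => deriv g x) this
    simp only [deriv_comp_add_const, deriv_add_const] at h
    simp [h]
  obtain ⟨x₁, hx₁⟩ := hp.exists_forall_le_of_continuous hF.continuous_deriv.neg
  exact ⟨deriv F x₁, fun x => by linarith [hx₁ x]⟩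

/-- A power-law normal form on a closed interval around the critical point. -/
theorem exists_normalForm (hF : UnicriticalLift F x₀) :
    ∃ (d r m M : ℝ) (W : Set ℝ) (φ : ℝ → ℝ), 1 < d ∧ 0 < r ∧ r < 1 / 2 ∧ 0 < m ∧ 0 < M ∧
      IsOpen W ∧ Icc (x₀ - r) (x₀ + r) ⊆ W ∧ ContDiffOn ℝ 3 φ W ∧ φ x₀ = 0 ∧
      (∀ y ∈ Icc (x₀ - r) (x₀ + r), 0 < deriv φ y) ∧
      (∀ y ∈ Icc (x₀ - r) (x₀ + r), F y = F x₀ + oddPow d (φ y)) ∧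
      ∀ x ∈ Icc (x₀ - r) (x₀ + r), ∀ y ∈ Icc (x₀ - r) (x₀ + r), x ≤ y →
        m * (y - x) ≤ φ y - φ x ∧ φ y - φ x ≤ M * (y - x) := by
  obtain ⟨d, hd, W, hW, hxW, φ, hφ, -, hφ', hφ0, hFφ⟩ := hF.nonFlat
  obtain ⟨r₀, hr₀, hball⟩ := Metric.isOpen_iff.1 hW x₀ hxW
  set r := min (r₀ / 2) (1 / 4) with hr
  have hrpos : 0 < r := by positivity
  have hrr₀ : r < r₀ := (min_le_left _ _).trans_lt (by linarith)
  set I := Icc (x₀ - r) (x₀ + r) with hI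
  have hIW : I ⊆ W := fun y hy => hball (by
    rw [Metric.mem_ball, Real.dist_eq, abs_lt]
    constructor <;> linarith [hy.1, hy.2])
  have hmono : StrictMonoOn φ W := fun x hx y hy hxy => by
    have := hF.strictMono hxy
    rw [hFφ x hx, hFφ y hy] at this
    by_contra hcon
    have h2 := (oddPow_strictMono hd).monotone (not_lt.1 hcon)
    unfold oddPow at h2
    linarith
  have hcont : ContinuousOn (deriv φ) W := hφ.continuousOn_deriv_of_isOpen hW (by norm_num)
  have hder : ∀ y ∈ W, HasDerivAt φ (deriv φ y) y := fun y hy =>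
    ((hφ.differentiableOn (by norm_num)).differentiableAt (hW.mem_nhds hy)).hasDerivAt
  have hpos : ∀ y ∈ W, 0 < deriv φ y := fun y hy => by
    refine lt_of_le_of_ne ?_ (hφ' y hy).symm
    have h1 : derivWithin φ W y = deriv φ y := derivWithin_of_isOpen hW hy
    rw [← h1]
    exact hmono.monotoneOn.derivWithin_nonneg
  have hne : I.Nonempty := nonempty_Icc.2 (by linarith)
  obtain ⟨x₁, hx₁, hmin⟩ := isCompact_Icc.exists_isMinOn hne (hcont.mono hIW)
  obtain ⟨x₂, hx₂, hmax⟩ := isCompact_Icc.exists_isMaxOn hne (hcont.mono hIW)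
  refine ⟨d, r, deriv φ x₁, deriv φ x₂, W, φ, hd, hrpos,
    (min_le_right _ _).trans_lt (by norm_num), hpos _ (hIW hx₁), hpos _ (hIW hx₂), hW, hIW, hφ, hφ0,
    fun y hy => hpos y (hIW hy), fun y hy => hFφ y (hIW hy), fun x hx y hy hxy => ?_⟩
  have hsub : Icc x y ⊆ I := Icc_subset_Icc hx.1 hy.2
  exact ⟨mul_le_sub_of_le_hasDerivAt hxy (fun t ht => hder t (hIW (hsub ht)))
      (fun t ht => hmin (hsub ht)),
    sub_le_mul_of_hasDerivAt_le hxy (fun t ht => hder t (hIW (hsub ht)))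
      (fun t ht => hmax (hsub ht))⟩

/-- Short intervals are, up to an integer translation, either close to or away from `x₀`. -/
theorem exists_int_near_or_away {r a d : ℝ} (hda : d - a ≤ r / 4) (hr : 0 < r) :
    ∃ k : ℤ, (x₀ - r ≤ a - k ∧ d - k ≤ x₀ + r) ∨
      (x₀ + r / 4 ≤ a - k ∧ d - k ≤ x₀ + 1 - r / 4) := by
  refine ⟨⌊a - (x₀ - r / 2)⌋, ?_⟩
  have h1 := Int.floor_le (a - (x₀ - r / 2))
  have h2 := Int.lt_floor_add_one (a - (x₀ - r / 2))
  rcases le_or_gt (a - ⌊a - (x₀ - r / 2)⌋) (x₀ + r / 2) with h3 | h3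
  · left; constructor <;> linarith
  · right; constructor <;> linarith

theorem map_sub_int (hF : UnicriticalLift F x₀) (x : ℝ) (k : ℤ) : F (x - k) = F x - k :=
  map_sub_int_of_map_add_one hF.map_add_one x k

/-- The supremum of `F'` over an interval is controlled by its average. -/
theorem exists_sub_mul_le (hF : UnicriticalLift F x₀) : ∃ C : ℝ, 1 ≤ C ∧ ∀ x s t y : ℝ,
    x ≤ s → s ≤ t → t ≤ y → y - x ≤ 1 → (F t - F s) * (y - x) ≤ C * (t - s) * (F y - F x) := by
  obtain ⟨d, r, m, M, W, φ, hd, hr, hr2, hm, hM, -, -, -, -, -, hFφ, hbilip⟩ :=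
    hF.exists_normalForm
  obtain ⟨D, hD⟩ := hF.exists_deriv_le
  have hup : ∀ s t, s ≤ t → F t - F s ≤ max D 0 * (t - s) := fun s t hst =>
    sub_le_mul_of_hasDerivAt_le hst (fun x _ => hF.hasDerivAt x)
      (fun x _ => (hD x).trans (le_max_left _ _))
  have hD0 : 0 ≤ max D 0 := le_max_right _ _
  have hinc : ∃ κ, 0 < κ ∧ ∀ x, κ ≤ F (x + r / 4) - F x := by
    have hp : Function.Periodic (fun x => F (x + r / 4) - F x) 1 := fun x => by
      have : x + 1 + r / 4 = x + r / 4 + 1 := by ring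
      simp only [this, hF.map_add_one]; ring
    have hc := hF.contDiff.continuous
    obtain ⟨x₁, hx₁⟩ := hp.exists_forall_le_of_continuous (by fun_prop)
    exact ⟨_, sub_pos.2 (hF.strictMono (by linarith)), hx₁⟩
  obtain ⟨κ, hκ, hκF⟩ := hinc
  have haway : ∃ μ, 0 < μ ∧ ∀ x ∈ Icc (x₀ + r / 4) (x₀ + 1 - r / 4), μ ≤ deriv F x := by
    obtain ⟨x₁, hx₁, hmin⟩ := isCompact_Icc.exists_isMinOn
      (nonempty_Icc.2 (by linarith : x₀ + r / 4 ≤ x₀ + 1 - r / 4)) hF.continuous_deriv.continuousOn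
    exact ⟨_, hF.deriv_pos_of_mem_Ioo ⟨by linarith [hx₁.1], by linarith [hx₁.2]⟩, hmin⟩
  obtain ⟨μ, hμ, hμF⟩ := haway
  set C₁ := max D 0 / κ
  set C₂ := M / m * (2 * d)
  set C₃ := max D 0 / μ
  have hC₁ : 0 ≤ C₁ := by positivity
  have hC₂ : 0 ≤ C₂ := by positivity
  have hC₃ : 0 ≤ C₃ := by positivity
  refine ⟨1 + C₁ + C₂ + C₃, by linarith, fun x s t y hxs hst hty hyx => ?_⟩
  have hxy : x ≤ y := by linarith
  have hFxy : 0 ≤ F y - F x := sub_nonneg.2 (hF.strictMono.monotone hxy)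
  have hP : 0 ≤ (t - s) * (F y - F x) := mul_nonneg (sub_nonneg.2 hst) hFxy
  suffices h : ∃ C, C ≤ 1 + C₁ + C₂ + C₃ ∧ (F t - F s) * (y - x) ≤ C * ((t - s) * (F y - F x)) by
    obtain ⟨C, hC, h⟩ := h
    have := mul_le_mul_of_nonneg_right hC hP
    linarith
  rcases le_or_gt (y - x) (r / 4) with hsmall | hbig
  · obtain ⟨k, h | h⟩ := exists_int_near_or_away (x₀ := x₀) hsmall hr
    · refine ⟨C₂, by linarith, ?_⟩
      have key : ∀ x s t y, x₀ - r ≤ x → x ≤ s → s ≤ t → t ≤ y → y ≤ x₀ + r →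
          (F t - F s) * (y - x) ≤ C₂ * ((t - s) * (F y - F x)) := by
        intro x s t y h1 h2 h3 h4 h5
        have mx : x ∈ Icc (x₀ - r) (x₀ + r) := ⟨by linarith, by linarith⟩
        have ms : s ∈ Icc (x₀ - r) (x₀ + r) := ⟨by linarith, by linarith⟩
        have mt : t ∈ Icc (x₀ - r) (x₀ + r) := ⟨by linarith, by linarith⟩
        have my : y ∈ Icc (x₀ - r) (x₀ + r) := ⟨by linarith, by linarith⟩
        have b1 := (hbilip x mx s ms h2).1
        have b2 := hbilip s ms t mt h3
        have b3 := (hbilip t mt y my h4).1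
        have b4 := (hbilip x mx y my (by linarith)).1
        have z1 : 0 ≤ m * (s - x) := mul_nonneg hm.le (by linarith)
        have z2 : 0 ≤ m * (t - s) := mul_nonneg hm.le (by linarith)
        have z3 : 0 ≤ m * (y - t) := mul_nonneg hm.le (by linarith)
        have hg := oddPow_sub_mul_le hd (by linarith : φ x ≤ φ s) (by linarith : φ s ≤ φ t)
          (by linarith : φ t ≤ φ y)
        have i1 := (oddPow_strictMono hd).monotone (by linarith : φ s ≤ φ t)
        have i2 := (oddPow_strictMono hd).monotone (by linarith : φ x ≤ φ y)
        rw [hFφ x mx, hFφ s ms, hFφ t mt, hFφ y my]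
        set gx := oddPow d (φ x)
        set gs := oddPow d (φ s)
        set gt := oddPow d (φ t)
        set gy := oddPow d (φ y)
        have j1 : (gt - gs) * (m * (y - x)) ≤ (gt - gs) * (φ y - φ x) :=
          mul_le_mul_of_nonneg_left b4 (by linarith)
        have j2 : 2 * d * (φ t - φ s) * (gy - gx) ≤ 2 * d * (M * (t - s)) * (gy - gx) := by
          refine mul_le_mul_of_nonneg_right ?_ (by linarith)
          exact mul_le_mul_of_nonneg_left b2.2 (by linarith)
        have j3 : m * ((gt - gs) * (y - x)) ≤ m * (C₂ * ((t - s) * (gy - gx))) := by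
          have : m * (C₂ * ((t - s) * (gy - gx))) = 2 * d * (M * (t - s)) * (gy - gx) := by
            simp only [C₂]; field_simp
          rw [this]; linarith
        have := le_of_mul_le_mul_left j3 hm
        linarith
      have := key (x - k) (s - k) (t - k) (y - k) h.1 (by linarith) (by linarith) (by linarith) h.2
      simp only [hF.map_sub_int] at this
      ring_nf at this ⊢
      exact this
    · refine ⟨C₃, by linarith, ?_⟩
      have hlow := mul_le_sub_of_le_hasDerivAt (f := F) (C := μ) (by linarith : x - k ≤ y - k)
        (fun z _ => hF.hasDerivAt z)
        (fun z hz => hμF z ⟨by linarith [hz.1], by linarith [hz.2]⟩)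
      simp only [hF.map_sub_int] at hlow
      have h1 : (F t - F s) * (y - x) ≤ max D 0 * (t - s) * (y - x) :=
        mul_le_mul_of_nonneg_right (hup s t hst) (by linarith)
      have h2 : C₃ * (t - s) * (μ * (y - x)) ≤ C₃ * (t - s) * (F y - F x) :=
        mul_le_mul_of_nonneg_left (by linarith) (mul_nonneg hC₃ (by linarith))
      have h3 : C₃ * (t - s) * (μ * (y - x)) = max D 0 * (t - s) * (y - x) := by
        simp only [C₃]; field_simp
      linarith
  · refine ⟨C₁, by linarith, ?_⟩
    have h0 := hup s t hst
    have hFst : 0 ≤ F t - F s := sub_nonneg.2 (hF.strictMono.monotone hst)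
    have h1 : (F t - F s) * (y - x) ≤ max D 0 * (t - s) := by nlinarith
    have hlow : κ ≤ F y - F x := by
      have := hF.strictMono.monotone (by linarith : x + r / 4 ≤ y)
      linarith [hκF x]
    have h2 : C₁ * (t - s) * κ ≤ C₁ * (t - s) * (F y - F x) :=
      mul_le_mul_of_nonneg_left hlow (mul_nonneg hC₁ (by linarith))
    have h3 : C₁ * (t - s) * κ = max D 0 * (t - s) := by simp only [C₁]; field_simp
    linarith

/-- Away from the critical point, short intervals have cross-ratio distortion close to `1`. -/
theorem exists_crossRatio_le_of_short (hF : UnicriticalLift F x₀) :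
    ∃ ε K : ℝ, 0 < ε ∧ 0 ≤ K ∧ ∀ a b c d : ℝ, a < b → b < c → c < d → d - a ≤ ε →
      (∀ k : ℤ, x₀ + k ∉ Icc a d) →
      crossRatio (F a) (F b) (F c) (F d) ≤ (1 + K * (d - a) ^ 2) * crossRatio a b c d := by
  obtain ⟨p, r, m, M, W, φ, hp, hr, hr2, hm, hM, hW, hIW, hφ, hφ0, hφ', hFφ, hbilip⟩ :=
    hF.exists_normalForm
  obtain ⟨K₁, hK₁, hφcr⟩ := exists_crossRatio_le_of_contDiffOn hW hIW hφ hφ'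
  obtain ⟨K₂, hK₂, hFcr⟩ := exists_crossRatio_le_of_contDiffOn (A := x₀ + r / 4)
    (B := x₀ + 1 - r / 4) isOpen_univ (subset_univ _) hF.contDiff.contDiffOn
    (fun x hx => hF.deriv_pos_of_mem_Ioo ⟨by linarith [hx.1], by linarith [hx.2]⟩)
  refine ⟨r / 4, K₁ + K₂, by positivity, by positivity, fun a b c d hab hbc hcd hda hcrit => ?_⟩
  have hcr := (crossRatio_pos hab hbc hcd).le
  have hshift : ∀ k : ℤ, ∀ K, K ≤ K₁ + K₂ →
      crossRatio (F (a - k)) (F (b - k)) (F (c - k)) (F (d - k)) ≤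
        (1 + K * ((d - k) - (a - k)) ^ 2) * crossRatio (a - k) (b - k) (c - k) (d - k) →
      crossRatio (F a) (F b) (F c) (F d) ≤
        (1 + (K₁ + K₂) * (d - a) ^ 2) * crossRatio a b c d := by
    intro k K hK h
    simp only [hF.map_sub_int] at h
    simp only [sub_eq_add_neg _ (k : ℝ), crossRatio_add_const] at h
    refine h.trans (mul_le_mul_of_nonneg_right ?_ hcr)
    have : d + -(k : ℝ) - (a + -(k : ℝ)) = d - a := by ring
    rw [this]
    have := mul_le_mul_of_nonneg_right hK (sq_nonneg (d - a))
    linarith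
  obtain ⟨k, h | h⟩ := exists_int_near_or_away (x₀ := x₀) hda hr
  · refine hshift k K₁ (by linarith) ?_
    have hk : x₀ ∉ Icc (a - k) (d - k) := fun hx =>
      hcrit k ⟨by linarith [hx.1], by linarith [hx.2]⟩
    have hx₀ : x₀ ∈ Icc (x₀ - r) (x₀ + r) := ⟨by linarith, by linarith⟩
    have key : ∀ a b c d, a < b → b < c → c < d → x₀ - r ≤ a → d ≤ x₀ + r → x₀ ∉ Icc a d →
        crossRatio (F a) (F b) (F c) (F d) ≤ (1 + K₁ * (d - a) ^ 2) * crossRatio a b c d := by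
      intro a b c d hab hbc hcd ha hd hx
      have ma : a ∈ Icc (x₀ - r) (x₀ + r) := ⟨by linarith, by linarith⟩
      have mb : b ∈ Icc (x₀ - r) (x₀ + r) := ⟨by linarith, by linarith⟩
      have mc : c ∈ Icc (x₀ - r) (x₀ + r) := ⟨by linarith, by linarith⟩
      have md : d ∈ Icc (x₀ - r) (x₀ + r) := ⟨by linarith, by linarith⟩
      refine le_trans ?_ (hφcr a b c d ha hab hbc hcd hd)
      have hlt : ∀ x ∈ Icc (x₀ - r) (x₀ + r), ∀ y ∈ Icc (x₀ - r) (x₀ + r), x < y → φ x < φ y :=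
        fun x hx y hy hxy => by
          have := (hbilip x hx y hy hxy.le).1
          have : 0 < m * (y - x) := mul_pos hm (sub_pos.2 hxy)
          linarith
      have l1 := hlt a ma b mb hab
      have l2 := hlt b mb c mc hbc
      have l3 := hlt c mc d md hcd
      rw [hFφ a ma, hFφ b mb, hFφ c mc, hFφ d md]
      simp only [add_comm (F x₀), crossRatio_add_const]
      rcases lt_or_ge x₀ a with hpos | hneg
      · have l0 := hlt x₀ hx₀ a ma hpos
        rw [hφ0] at l0
        rw [oddPow_of_nonneg hp l0.le, oddPow_of_nonneg hp (by linarith),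
          oddPow_of_nonneg hp (by linarith), oddPow_of_nonneg hp (by linarith)]
        exact crossRatio_rpow_le l0 l1 l2 l3 hp.le
      · have hdx : d < x₀ := by
          by_contra hcon
          exact hx ⟨hneg, not_lt.1 hcon⟩
        have l0 := hlt d md x₀ hx₀ hdx
        rw [hφ0] at l0
        have e : ∀ u, u < 0 → oddPow p u = -((-u) ^ p) := fun u hu => by
          rw [← oddPow_of_nonneg hp (by linarith : 0 ≤ -u), oddPow_neg, neg_neg]
        rw [e (φ a) (by linarith), e (φ b) (by linarith), e (φ c) (by linarith),
          e (φ d) (by linarith), crossRatio_neg, ← crossRatio_neg (φ a)]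
        exact crossRatio_rpow_le (by linarith) (by linarith) (by linarith) (by linarith) hp.le
    exact key _ _ _ _ (by linarith) (by linarith) (by linarith) h.1 h.2 hk
  · exact hshift k K₂ (by linarith)
      (hFcr _ _ _ _ h.1 (by linarith) (by linarith) (by linarith) h.2)

/-- Distortion of cross-ratios under one iterate: a fixed factor if the interval meets the critical
set, and close to `1` otherwise. -/
theorem exists_crossRatio_le (hF : UnicriticalLift F x₀) :
    ∃ K : ℝ, 0 ≤ K ∧ ∀ a b c d : ℝ, a < b → b < c → c < d → d - a ≤ 1 →
      (crossRatio (F a) (F b) (F c) (F d) ≤ Real.exp (K * (d - a) + K) * crossRatio a b c d) ∧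
      ((∀ k : ℤ, x₀ + k ∉ Icc a d) →
        crossRatio (F a) (F b) (F c) (F d) ≤ Real.exp (K * (d - a)) * crossRatio a b c d) := by
  obtain ⟨C, hC1, hC⟩ := hF.exists_sub_mul_le
  obtain ⟨ε, K, hε, hK, hshort⟩ := hF.exists_crossRatio_le_of_short
  have hlogC : 0 ≤ 2 * Real.log C := by have := Real.log_nonneg hC1; linarith
  set K₁ := K + 2 * Real.log C + 2 * Real.log C / ε with hK₁
  have hdiv : 0 ≤ 2 * Real.log C / ε := by positivity
  have hK₁0 : 0 ≤ K₁ := by positivity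
  refine ⟨K₁, hK₁0, fun a b c d hab hbc hcd hda => ?_⟩
  have hcr := (crossRatio_pos hab hbc hcd).le
  have hrough : crossRatio (F a) (F b) (F c) (F d) ≤
      Real.exp (2 * Real.log C) * crossRatio a b c d := by
    have hexp : Real.exp (2 * Real.log C) = C * C := by
      rw [two_mul, Real.exp_add, Real.exp_log (by linarith)]
    have f1 := sub_pos.2 (hF.strictMono hab)
    have f2 := sub_pos.2 (hF.strictMono hbc)
    have f3 := sub_pos.2 (hF.strictMono hcd)
    have g1 : 0 < F c - F a := by linarith
    have g2 : 0 < F d - F b := by linarith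
    have k1 : 0 < c - a := by linarith
    have k2 : 0 < d - b := by linarith
    have h1 := hC a a b c le_rfl hab.le hbc.le (by linarith)
    have h2 := hC b c d d hbc.le hcd.le le_rfl (by linarith)
    have e : ∀ p q r s : ℝ, p * q / (r * s) = p / r * (q / s) := fun p q r s => by
      rw [div_mul_div_comm]
    unfold crossRatio
    rw [hexp, e, e (b - a)]
    have i1 : (F b - F a) / (F c - F a) ≤ C * ((b - a) / (c - a)) := by
      rw [← mul_div_assoc, div_le_div_iff₀ g1 k1]; linarith
    have i2 : (F d - F c) / (F d - F b) ≤ C * ((d - c) / (d - b)) := by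
      rw [← mul_div_assoc, div_le_div_iff₀ g2 k2]; linarith
    calc _ ≤ C * ((b - a) / (c - a)) * (C * ((d - c) / (d - b))) :=
          mul_le_mul i1 i2 (by positivity)
            (mul_nonneg (by linarith) (div_nonneg (by linarith) k1.le))
      _ = _ := by ring
  refine ⟨hrough.trans (mul_le_mul_of_nonneg_right (Real.exp_le_exp.2 ?_) hcr), fun hcrit => ?_⟩
  · have : 0 ≤ K₁ * (d - a) := mul_nonneg hK₁0 (by linarith)
    linarith
  · rcases le_or_gt (d - a) ε with h | h
    · refine (hshort a b c d hab hbc hcd h hcrit).trans (mul_le_mul_of_nonneg_right ?_ hcr)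
      have h1 := Real.add_one_le_exp (K₁ * (d - a))
      have h2 : K * (d - a) ^ 2 ≤ K₁ * (d - a) := by
        have : K * ((d - a) * (d - a)) ≤ K₁ * ((d - a) * 1) :=
          mul_le_mul (by linarith) (mul_le_mul_of_nonneg_left hda (by linarith))
            (mul_nonneg (by linarith) (by linarith)) hK₁0
        linarith
      linarith
    · refine hrough.trans (mul_le_mul_of_nonneg_right (Real.exp_le_exp.2 ?_) hcr)
      have h1 : 2 * Real.log C / ε * ε ≤ K₁ * (d - a) :=
        mul_le_mul (by linarith) h.le hε.le hK₁0
      rwa [div_mul_cancel₀ _ hε.ne'] at h1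

/-- Near the critical point, `F` contracts by a power. -/
theorem exists_map_sub_le_rpow (hF : UnicriticalLift F x₀) :
    ∃ C r p : ℝ, 0 < C ∧ 0 < r ∧ 1 < p ∧ ∀ σ s : ℝ, 0 < σ → σ ≤ r → 0 < s → s ≤ 1 →
      F (x₀ + s * σ) - F x₀ ≤ C * s ^ p * (F (x₀ + σ) - F x₀) := by
  obtain ⟨p, r, m, M, W, φ, hp, hr, hr2, hm, hM, -, -, -, hφ0, -, hFφ, hbilip⟩ :=
    hF.exists_normalForm
  refine ⟨(M / m) ^ p, r, p, Real.rpow_pos_of_pos (by positivity) _, hr, hp,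
    fun σ s hσ hσr hs hs1 => ?_⟩
  have hsσ : 0 < s * σ := by positivity
  have hsσ' : s * σ ≤ σ := by nlinarith
  have m0 : x₀ ∈ Icc (x₀ - r) (x₀ + r) := ⟨by linarith, by linarith⟩
  have m1 : x₀ + s * σ ∈ Icc (x₀ - r) (x₀ + r) := ⟨by linarith, by linarith⟩
  have m2 : x₀ + σ ∈ Icc (x₀ - r) (x₀ + r) := ⟨by linarith, by linarith⟩
  have b1 := hbilip _ m0 _ m1 (by linarith)
  have b2 := hbilip _ m0 _ m2 (by linarith)
  simp only [hφ0, add_sub_cancel_left, sub_zero] at b1 b2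
  have q1 : 0 ≤ φ (x₀ + s * σ) := le_trans (by positivity) b1.1
  have q2 : 0 ≤ φ (x₀ + σ) := le_trans (by positivity) b2.1
  rw [hFφ _ m1, hFφ _ m2, oddPow_of_nonneg hp q1, oddPow_of_nonneg hp q2, add_sub_cancel_left,
    add_sub_cancel_left, ← Real.mul_rpow (by positivity) hs.le,
    ← Real.mul_rpow (by positivity) q2]
  refine Real.rpow_le_rpow q1 ?_ (by linarith)
  calc φ (x₀ + s * σ) ≤ M * (s * σ) := b1.2
    _ = M / m * s * (m * σ) := by field_simp
    _ ≤ M / m * s * φ (x₀ + σ) := mul_le_mul_of_nonneg_left b2.1 (by positivity)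

end UnicriticalLift

/-! ### Iterates -/

theorem exists_int_mem_Icc_of_mem_closedBall {a b z : ℝ}
    (h : (z : S1) ∈ Metric.closedBall (((a + b) / 2 : ℝ) : S1) ((b - a) / 2)) :
    ∃ k : ℤ, z + k ∈ Icc a b := by
  rw [mem_closedBall_iff_norm, ← AddCircle.coe_sub, UnitAddCircle.norm_eq, abs_le] at h
  refine ⟨-round (z - (a + b) / 2), ?_, ?_⟩ <;> push_cast <;> linarith [h.1, h.2]

/-- Intervals of length at most one covering every point of the circle at most `m` times have
total length at most `m`. -/
theorem sum_length_le_of_multiplicity_le {n m : ℕ} {a b : ℕ → ℝ}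
    (hab : ∀ j < n, a j ≤ b j) (hle : ∀ j < n, b j - a j ≤ 1)
    (hm : ∀ z : ℝ, ∀ s ⊆ Finset.range n, (∀ j ∈ s, ∃ k : ℤ, z + k ∈ Icc (a j) (b j)) →
      s.card ≤ m) :
    ∑ j ∈ Finset.range n, (b j - a j) ≤ m := by
  classical
  set B : ℕ → Set S1 := fun j => Metric.closedBall (((a j + b j) / 2 : ℝ) : S1) ((b j - a j) / 2)
    with hB
  have hvol : ∀ j ∈ Finset.range n, volume (B j) = ENNReal.ofReal (b j - a j) := by
    intro j hj
    rw [Finset.mem_range] at hj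
    rw [hB, AddCircle.volume_closedBall, mul_div_cancel₀ _ (two_ne_zero), min_eq_right (hle j hj)]
  have hpt : ∀ z : S1, ∑ j ∈ Finset.range n, (B j).indicator (fun _ => (1 : ENNReal)) z ≤ m := by
    intro z
    induction z using QuotientAddGroup.induction_on with
    | H z =>
      have : ∑ j ∈ Finset.range n, (B j).indicator (fun _ => (1 : ENNReal)) (z : S1) =
          (((Finset.range n).filter fun j => (z : S1) ∈ B j).card : ENNReal) := by
        simp [Set.indicator_apply]
      refine this.le.trans ?_
      have := hm z ((Finset.range n).filter fun j => (z : S1) ∈ B j) (Finset.filter_subset _ _)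
        (fun j hj => exists_int_mem_Icc_of_mem_closedBall (Finset.mem_filter.1 hj).2)
      exact_mod_cast this
  have hsum : ∑ j ∈ Finset.range n, volume (B j) ≤ m := by
    calc ∑ j ∈ Finset.range n, volume (B j)
        = ∑ j ∈ Finset.range n, ∫⁻ z, (B j).indicator (fun _ => (1 : ENNReal)) z := by
          refine Finset.sum_congr rfl fun j _ => ?_
          rw [lintegral_indicator_const Metric.isClosed_closedBall.measurableSet, one_mul]
      _ = ∫⁻ z : S1, ∑ j ∈ Finset.range n, (B j).indicator (fun _ => (1 : ENNReal)) z := by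
          rw [lintegral_finsetSum]
          exact fun j _ => measurable_const.indicator Metric.isClosed_closedBall.measurableSet
      _ ≤ ∫⁻ _ : S1, (m : ENNReal) := lintegral_mono hpt
      _ = m := by simp [AddCircle.measure_univ]
  rw [Finset.sum_congr rfl hvol, ← ENNReal.ofReal_sum_of_nonneg] at hsum
  · rw [← ENNReal.ofReal_natCast] at hsum
    exact (ENNReal.ofReal_le_ofReal_iff (Nat.cast_nonneg _)).1 hsum
  · intro j hj
    linarith [hab j (Finset.mem_range.1 hj)]

/-- `Φ` is a monotone degree-one semiconjugacy from `F` to the translation by `ρ`. -/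
structure RotSemiconj (F Φ : ℝ → ℝ) (ρ : ℝ) : Prop where
  monotone : Monotone Φ
  map_add_one : ∀ x, Φ (x + 1) = Φ x + 1
  semiconj : ∀ x, Φ (F x) = Φ x + ρ

namespace RotSemiconj

variable {F Φ : ℝ → ℝ} {ρ : ℝ}

theorem map_add_int (h : RotSemiconj F Φ ρ) (x : ℝ) (k : ℤ) : Φ (x + k) = Φ x + k :=
  map_add_int_of_map_add_one h.map_add_one x k

theorem iterate (h : RotSemiconj F Φ ρ) (n : ℕ) (x : ℝ) : Φ (F^[n] x) = Φ x + n * ρ := by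
  induction n with
  | zero => simp
  | succ n ih => rw [Function.iterate_succ_apply', h.semiconj, ih]; push_cast; ring

theorem sub_lt_one (h : RotSemiconj F Φ ρ) {x y : ℝ} (hxy : Φ y - Φ x < 1) : y - x < 1 := by
  by_contra! hc
  have := h.monotone (show x + 1 ≤ y by linarith)
  rw [h.map_add_one] at this
  linarith

theorem iterate_sub_lt_one (h : RotSemiconj F Φ ρ) {x y : ℝ} (hxy : Φ y - Φ x < 1) (n : ℕ) :
    F^[n] y - F^[n] x < 1 := by
  apply h.sub_lt_one
  rw [h.iterate, h.iterate]
  linarith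

theorem card_le_of_separated (h : RotSemiconj F Φ ρ) {a d sep : ℝ} {N Q n : ℕ} (hsep : 0 < sep)
    (hQ : ∀ j : ℕ, 0 < j → j < Q → ∀ k : ℤ, sep ≤ |j * ρ - k|) (hn : n ≤ Q)
    (hN : Φ d - Φ a < N * sep) (z : ℝ) (s : Finset ℕ) (hs : s ⊆ Finset.range n)
    (hz : ∀ j ∈ s, ∃ k : ℤ, z + k ∈ Icc (F^[j] a) (F^[j] d)) : s.card ≤ N := by
  choose! k hk using hz
  set u : ℕ → ℝ := fun j => Φ z + k j - j * ρ - Φ a with hu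
  have hu0 : ∀ j ∈ s, 0 ≤ u j ∧ u j ≤ Φ d - Φ a := by
    intro j hj
    have h1 := h.monotone (hk j hj).1
    have h2 := h.monotone (hk j hj).2
    rw [h.iterate, h.map_add_int] at h1 h2
    constructor <;> simp only [hu] <;> linarith
  have hmaps : ∀ j ∈ s, ⌊u j / sep⌋₊ ∈ Finset.range N := by
    intro j hj
    have := hu0 j hj
    rw [Finset.mem_range, Nat.floor_lt (by have := this.1; positivity), div_lt_iff₀ hsep]
    linarith
  have key : ∀ i ∈ s, ∀ j ∈ s, ⌊u i / sep⌋₊ = ⌊u j / sep⌋₊ → i < j → False := by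
    intro i hi j hj hij hlt
    have hjn : j < n := Finset.mem_range.1 (hs hj)
    have hd : |u i / sep - u j / sep| < 1 := by
      have h1 := Nat.floor_le (show 0 ≤ u i / sep from div_nonneg (hu0 i hi).1 hsep.le)
      have h2 := Nat.floor_le (show 0 ≤ u j / sep from div_nonneg (hu0 j hj).1 hsep.le)
      have h3 := Nat.lt_floor_add_one (u i / sep)
      have h4 := Nat.lt_floor_add_one (u j / sep)
      rw [hij] at h1 h3
      rw [abs_lt]
      constructor <;> linarith
    rw [← sub_div, abs_div, abs_of_pos hsep, div_lt_one hsep] at hd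
    have := hQ (j - i) (by omega) (by omega) (k j - k i)
    have e : ((j - i : ℕ) : ℝ) * ρ - ((k j - k i : ℤ) : ℝ) = u i - u j := by
      rw [Nat.cast_sub hlt.le]
      simp only [hu]
      push_cast
      ring
    rw [e] at this
    linarith
  rw [← Finset.card_range N]
  refine Finset.card_le_card_of_injOn _ hmaps fun i hi j hj hij => ?_
  rcases lt_trichotomy i j with hlt | heq | hlt
  · exact (key i hi j hj hij hlt).elim
  · exact heq
  · exact (key j hj i hi hij.symm hlt).elim

theorem sum_iterate_sub_le (h : RotSemiconj F Φ ρ) (hF : Monotone F) {a d sep : ℝ} {N Q n : ℕ}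
    (had : a ≤ d) (hsep : 0 < sep)
    (hQ : ∀ j : ℕ, 0 < j → j < Q → ∀ k : ℤ, sep ≤ |j * ρ - k|) (hn : n ≤ Q)
    (hN : Φ d - Φ a < N * sep) (h1 : Φ d - Φ a < 1) :
    ∑ j ∈ Finset.range n, (F^[j] d - F^[j] a) ≤ N :=
  sum_length_le_of_multiplicity_le (fun j _ => hF.iterate j had)
    (fun j _ => (h.iterate_sub_lt_one h1 j).le) (h.card_le_of_separated hsep hQ hn hN)

end RotSemiconj

namespace UnicriticalLift

variable {F Φ : ℝ → ℝ} {x₀ ρ : ℝ}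

/-- The cross-ratio inequality for iterates. -/
theorem exists_iterate_crossRatio_le (hF : UnicriticalLift F x₀) (hΦ : RotSemiconj F Φ ρ) :
    ∃ K : ℝ, 0 ≤ K ∧ ∀ (N Q n : ℕ) (sep a b c d : ℝ), a < b → b < c → c < d → 0 < sep →
      (∀ j : ℕ, 0 < j → j < Q → ∀ k : ℤ, sep ≤ |j * ρ - k|) → n ≤ Q → Φ d - Φ a < N * sep →
      Φ d - Φ a < 1 →
      crossRatio (F^[n] a) (F^[n] b) (F^[n] c) (F^[n] d) ≤
        Real.exp (K * N) * crossRatio a b c d := by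
  classical
  obtain ⟨K, hK, hcr⟩ := hF.exists_crossRatio_le
  refine ⟨2 * K, by positivity, fun N Q n sep a b c d hab hbc hcd hsep hQ hn hN h1 => ?_⟩
  have hpos := crossRatio_pos hab hbc hcd
  set χ : ℕ → ℝ := fun j => if ∃ k : ℤ, x₀ + k ∈ Icc (F^[j] a) (F^[j] d) then 1 else 0 with hχ
  have hprod : ∀ m : ℕ, crossRatio (F^[m] a) (F^[m] b) (F^[m] c) (F^[m] d) ≤
      Real.exp (K * ∑ j ∈ Finset.range m, (F^[j] d - F^[j] a) + K * ∑ j ∈ Finset.range m, χ j) *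
        crossRatio a b c d := by
    intro m
    induction m with
    | zero => simp
    | succ m ih =>
      have hm := hcr (F^[m] a) (F^[m] b) (F^[m] c) (F^[m] d) (hF.strictMono.iterate m hab)
        (hF.strictMono.iterate m hbc) (hF.strictMono.iterate m hcd)
        (hΦ.iterate_sub_lt_one h1 m).le
      have hstep : crossRatio (F (F^[m] a)) (F (F^[m] b)) (F (F^[m] c)) (F (F^[m] d)) ≤
          Real.exp (K * (F^[m] d - F^[m] a) + K * χ m) *
            crossRatio (F^[m] a) (F^[m] b) (F^[m] c) (F^[m] d) := by
        by_cases hx : ∃ k : ℤ, x₀ + k ∈ Icc (F^[m] a) (F^[m] d)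
        · simpa only [hχ, if_pos hx, mul_one] using hm.1
        · simpa only [hχ, if_neg hx, mul_zero, add_zero] using hm.2 (not_exists.1 hx)
      simp only [Function.iterate_succ_apply']
      refine hstep.trans ((mul_le_mul_of_nonneg_left ih (Real.exp_pos _).le).trans_eq ?_)
      rw [← mul_assoc, ← Real.exp_add, Finset.sum_range_succ, Finset.sum_range_succ]
      congr 2
      ring
  refine (hprod n).trans (mul_le_mul_of_nonneg_right (Real.exp_le_exp.2 ?_) hpos.le)
  have hlen := hΦ.sum_iterate_sub_le hF.strictMono.monotone (hab.trans (hbc.trans hcd)).le hsep hQ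
    hn hN h1
  have hcard : ∑ j ∈ Finset.range n, χ j ≤ N := by
    have : ∑ j ∈ Finset.range n, χ j = (((Finset.range n).filter fun j =>
        ∃ k : ℤ, x₀ + k ∈ Icc (F^[j] a) (F^[j] d)).card : ℝ) := by
      simp [hχ]
    rw [this]
    exact_mod_cast hΦ.card_le_of_separated hsep hQ hn hN x₀ _ (Finset.filter_subset _ _)
      fun j hj => (Finset.mem_filter.1 hj).2
  nlinarith [mul_le_mul_of_nonneg_left hlen hK, mul_le_mul_of_nonneg_left hcard hK]

end UnicriticalLift

/-! ### Existence of the conjugacy to a rotation -/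

theorem exists_rotSemiconj {F : ℝ → ℝ} {ρ : ℝ} (hmono : StrictMono F)
    (hsurj : Function.Surjective F) (hF : ∀ x, F (x + 1) = F x + 1)
    (hlim : Tendsto (fun n : ℕ => F^[n] 0 / (n : ℝ)) atTop (𝓝 ρ)) :
    ∃ Φ : ℝ → ℝ, RotSemiconj F Φ ρ := by
  let f : CircleDeg1Lift := ⟨⟨F, hmono.monotone⟩, hF⟩
  let g : CircleDeg1Lift := (CircleDeg1Lift.translate (Multiplicative.ofAdd ρ) : CircleDeg1Liftˣ)
  have hf : f.translationNumber = ρ := f.translationNumber_eq_of_tendsto₀ hlim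
  have hg : g.translationNumber = ρ := CircleDeg1Lift.translationNumber_translate ρ
  obtain ⟨Φ, hΦ⟩ := CircleDeg1Lift.semiconj_of_bijective_of_translationNumber_eq (f₁ := f) (f₂ := g)
    ⟨hmono.injective, hsurj⟩ (CircleDeg1Lift.isUnit_iff_bijective.1 (Units.isUnit _))
    (hf.trans hg.symm)
  exact ⟨Φ, Φ.monotone, Φ.map_add_one, fun x => (hΦ x).trans (add_comm _ _)⟩

theorem surjective_of_continuous_of_map_add_one {F : ℝ → ℝ} (hc : Continuous F)
    (hF : ∀ x, F (x + 1) = F x + 1) : Function.Surjective F := by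
  intro y
  obtain ⟨k, hk⟩ := exists_nat_gt |y - F 0|
  rw [abs_lt] at hk
  have h1 := map_add_int_of_map_add_one hF 0 k
  have h2 := map_add_int_of_map_add_one hF 0 (-k)
  push_cast at h1 h2
  rw [zero_add] at h1 h2
  obtain ⟨x, -, hx⟩ := intermediate_value_Icc (show (-k : ℝ) ≤ k by linarith) hc.continuousOn
    (show y ∈ Icc (F (-k)) (F k) from ⟨by linarith [hk.1], by linarith [hk.2]⟩)
  exact ⟨x, hx⟩

/-- A property of translations which is stable under composition and inversion and holds for `1`
and an irrational `ρ` holds for a dense set of translations. -/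
theorem dense_of_addSubgroup {ρ : ℝ} (hρ : Irrational ρ) {G : AddSubgroup ℝ} (h1 : (1 : ℝ) ∈ G)
    (h2 : ρ ∈ G) : Dense (G : Set ℝ) := by
  have : Dense (AddSubgroup.closure {ρ, (1 : ℝ)} : Set ℝ) :=
    dense_addSubgroupClosure_pair_iff.2 (by simpa using hρ)
  refine this.mono ((AddSubgroup.closure_le G).2 ?_)
  rintro x (rfl | rfl)
  exacts [h2, h1]

theorem exists_separation {ρ : ℝ} (hρ : Irrational ρ) (Q : ℕ) :
    ∃ sep : ℝ, 0 < sep ∧ ∀ j : ℕ, 0 < j → j < Q → ∀ k : ℤ, sep ≤ |j * ρ - k| := by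
  induction Q with
  | zero => exact ⟨1, one_pos, fun j _ h => absurd h (Nat.not_lt_zero j)⟩
  | succ Q ih =>
    obtain ⟨sep, hsep, h⟩ := ih
    rcases Nat.eq_zero_or_pos Q with rfl | hQ
    · exact ⟨1, one_pos, fun j h0 h => by omega⟩
    refine ⟨min sep |Q * ρ - round (Q * ρ)|, lt_min hsep (abs_pos.2 ?_), fun j h0 hj k => ?_⟩
    · exact ((hρ.natCast_mul hQ.ne').sub_intCast _).ne_zero
    · rcases Nat.lt_succ_iff_lt_or_eq.1 hj with hj | rfl
      · exact (min_le_left _ _).trans (h j h0 hj k)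
      · exact (min_le_right _ _).trans (round_le _ _)

/-- Among the members of a null sequence indexed by an orbit of a rotation one finds an arbitrarily
small one which is not larger than suitable neighbours on both sides. -/
theorem exists_small_with_neighbours {ρ : ℝ} (hρ : Irrational ρ) {l : ℕ → ℝ} (hpos : ∀ n, 0 < l n)
    (hlim : Tendsto l atTop (𝓝 0)) {ε : ℝ} (hε : 0 < ε) :
    ∃ (n Q : ℕ) (δ : ℝ), 0 < δ ∧ δ < 1 / 2 ∧
      (∀ j : ℕ, 0 < j → j < Q → ∀ k : ℤ, δ ≤ |j * ρ - k|) ∧ n ≤ 2 * Q ∧ l n < ε ∧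
      (∃ (m : ℕ) (k : ℤ), l n ≤ l m ∧ n * ρ - δ ≤ m * ρ - k ∧ m * ρ - k < n * ρ) ∧
      (∃ (m : ℕ) (k : ℤ), l n ≤ l m ∧ n * ρ < m * ρ - k ∧ m * ρ - k ≤ n * ρ + δ) := by
  classical
  have hex : ∃ n, l n < min ε (l 0) := (hlim.eventually_lt_const (lt_min hε (hpos 0))).exists
  set n₀ := Nat.find hex with hn₀
  have hn₀spec : l n₀ < min ε (l 0) := Nat.find_spec hex
  have hn₀min : ∀ j < n₀, min ε (l 0) ≤ l j := fun j hj => not_lt.1 (Nat.find_min hex hj)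
  have hn₀pos : 0 < n₀ := by
    rcases Nat.eq_zero_or_pos n₀ with h | h
    · rw [h] at hn₀spec
      exact absurd (hn₀spec.trans_le (min_le_right _ _)) (lt_irrefl _)
    · exact h
  obtain ⟨q, hq, hqmin⟩ := Finset.exists_min_image (Finset.Icc 1 n₀)
    (fun j : ℕ => |j * ρ - round (j * ρ)|) ⟨1, Finset.mem_Icc.2 ⟨le_rfl, hn₀pos⟩⟩
  rw [Finset.mem_Icc] at hq
  have hirr : ∀ (j : ℕ) (k : ℤ), 0 < j → (j * ρ - k : ℝ) ≠ 0 := fun j k hj =>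
    ((hρ.natCast_mul hj.ne').sub_intCast _).ne_zero
  set p := round (q * ρ) with hp
  set δ := |q * ρ - p| with hδ
  have hδ0 : 0 < δ := abs_pos.2 (hirr q p hq.1)
  have hδ2 : δ < 1 / 2 := by
    refine lt_of_le_of_ne (abs_sub_round _) fun h => ?_
    have hi := (hρ.natCast_mul (Nat.pos_iff_ne_zero.1 hq.1)).sub_intCast p
    rcases abs_cases (q * ρ - p) with ⟨h', -⟩ | ⟨h', -⟩
    · exact hi.ne_rat (1 / 2) (by push_cast; linarith)
    · exact hi.ne_rat (-(1 / 2)) (by push_cast; linarith)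
  have hexQ : ∃ Q : ℕ, 0 < Q ∧ |Q * ρ - round (Q * ρ)| < δ := by
    obtain ⟨n, hn⟩ := exists_nat_one_div_lt hδ0
    obtain ⟨k, hk0, -, hk⟩ := Real.exists_nat_abs_mul_sub_round_le ρ (Nat.succ_pos n)
    refine ⟨k, hk0, hk.trans_lt (lt_of_le_of_lt ?_ hn)⟩
    push_cast
    exact one_div_le_one_div_of_le (by positivity) (by linarith)
  set Q := Nat.find hexQ with hQ
  obtain ⟨hQ0, hQδ⟩ : 0 < Q ∧ |Q * ρ - round (Q * ρ)| < δ := Nat.find_spec hexQ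
  have hQmin : ∀ j : ℕ, 0 < j → j < Q → ∀ k : ℤ, δ ≤ |j * ρ - k| := fun j h0 hj k => by
    refine le_trans ?_ (round_le _ k)
    by_contra! h
    exact Nat.find_min hexQ hj ⟨h0, h⟩
  set P := round (Q * ρ) with hP
  have hQn₀ : n₀ < Q := by
    by_contra! h
    have := hqmin Q (Finset.mem_Icc.2 ⟨hQ0, h⟩)
    linarith
  have hopp : δ ≤ |(q * ρ - p) - (Q * ρ - P)| := by
    have := hQmin (Q - q) (by omega) (by omega) (P - p)
    rw [Nat.cast_sub (by omega)] at this
    push_cast at this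
    rw [abs_sub_comm]
    convert this using 2
    ring
  have hopp' : (0 < q * ρ - p ∧ Q * ρ - P < 0) ∨ (q * ρ - p < 0 ∧ 0 < Q * ρ - P) := by
    have hQ1 := hirr Q P hQ0
    have h := hopp
    rw [abs_lt] at hQδ
    rcases lt_or_gt_of_ne (hirr q p hq.1) with h1 | h1
    · right
      refine ⟨h1, lt_of_le_of_ne ?_ hQ1.symm⟩
      by_contra! h2
      rw [hδ, abs_of_neg h1] at hQδ h
      rw [le_abs] at h
      rcases h with h | h <;> linarith [hQδ.1, hQδ.2]
    · left
      refine ⟨h1, lt_of_le_of_ne ?_ hQ1⟩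
      by_contra! h2
      rw [hδ, abs_of_pos h1] at hQδ h
      rw [le_abs] at h
      rcases h with h | h <;> linarith [hQδ.1, hQδ.2]
  have hexi : ∃ i : ℕ, ¬ (l (n₀ + (i + 1) * q) < l (n₀ + i * q) ∧ n₀ + i * q < Q) :=
    ⟨Q, fun h => by have := h.2; nlinarith⟩
  set i := Nat.find hexi with hi
  have hispec : ¬ (l (n₀ + (i + 1) * q) < l (n₀ + i * q) ∧ n₀ + i * q < Q) := Nat.find_spec hexi
  have himin : ∀ j < i, l (n₀ + (j + 1) * q) < l (n₀ + j * q) ∧ n₀ + j * q < Q :=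
    fun j hj => not_not.1 (Nat.find_min hexi hj)
  have hdec : ∀ j ≤ i, l (n₀ + j * q) ≤ l n₀ := by
    intro j
    induction j with
    | zero => simp
    | succ j ih => exact fun hj => (himin j hj).1.le.trans (ih (by omega))
  set n := n₀ + i * q with hn
  have hln : l n ≤ l n₀ := hdec i le_rfl
  have hqn : q ≤ n := by omega
  have hleft : l n ≤ l (n - q) := by
    rcases Nat.eq_zero_or_pos i with h0 | h0
    · refine hln.trans (hn₀spec.le.trans (hn₀min _ ?_))
      rw [h0] at hn
      omega
    · have := (himin (i - 1) (by omega)).1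
      have e1 : n₀ + (i - 1 + 1) * q = n := by rw [Nat.sub_add_cancel h0]
      have e2 : n₀ + (i - 1) * q = n - q := by
        rw [Nat.sub_mul, one_mul, hn]
        have : q ≤ i * q := Nat.le_mul_of_pos_left q h0
        omega
      rw [e1, e2] at this
      exact this.le
  have hnQ : n < Q + q := by
    rcases Nat.eq_zero_or_pos i with h0 | h0
    · rw [h0] at hn
      omega
    · have := (himin (i - 1) (by omega)).2
      rw [Nat.sub_mul, one_mul] at this
      omega
  have hfin : ∀ (m₁ m₂ : ℕ) (k₁ k₂ : ℤ) (u₁ u₂ : ℝ), l n ≤ l m₁ → l n ≤ l m₂ →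
      m₁ * ρ - k₁ = n * ρ + u₁ → m₂ * ρ - k₂ = n * ρ + u₂ → |u₁| ≤ δ → |u₂| ≤ δ →
      (u₁ < 0 ∧ 0 < u₂ ∨ 0 < u₁ ∧ u₂ < 0) →
      (∃ (m : ℕ) (k : ℤ), l n ≤ l m ∧ n * ρ - δ ≤ m * ρ - k ∧ m * ρ - k < n * ρ) ∧
      (∃ (m : ℕ) (k : ℤ), l n ≤ l m ∧ n * ρ < m * ρ - k ∧ m * ρ - k ≤ n * ρ + δ) := by
    intro m₁ m₂ k₁ k₂ u₁ u₂ hl₁ hl₂ e₁ e₂ h₁ h₂ h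
    rw [abs_le] at h₁ h₂
    rcases h with h | h
    · exact ⟨⟨m₁, k₁, hl₁, by linarith, by linarith⟩, ⟨m₂, k₂, hl₂, by linarith, by linarith⟩⟩
    · exact ⟨⟨m₂, k₂, hl₂, by linarith, by linarith⟩, ⟨m₁, k₁, hl₁, by linarith, by linarith⟩⟩
  refine ⟨n, Q, δ, hδ0, hδ2, hQmin, by omega,
    hln.trans_lt (hn₀spec.trans_le (min_le_left _ _)), ?_⟩
  rcases lt_or_ge n Q with hlt | hge
  · have hright : l n ≤ l (n + q) := by
      by_contra! h
      refine hispec ⟨?_, hlt⟩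
      have : n₀ + (i + 1) * q = n + q := by rw [hn]; ring
      rwa [this]
    refine hfin (n - q) (n + q) (-p) p (-(q * ρ - p)) (q * ρ - p) hleft hright ?_ ?_
      (abs_neg _).le le_rfl ?_
    · rw [Nat.cast_sub hqn]; push_cast; ring
    · push_cast; ring
    · rcases hopp' with h | h
      · left; constructor <;> linarith [h.1]
      · right; constructor <;> linarith [h.1]
  · have hQl : l n ≤ l (n - Q) := hln.trans (hn₀spec.le.trans (hn₀min _ (by omega)))
    refine hfin (n - q) (n - Q) (-p) (-P) (-(q * ρ - p)) (-(Q * ρ - P)) hleft hQl ?_ ?_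
      (abs_neg _).le ((abs_neg _).trans_le hQδ.le) ?_
    · rw [Nat.cast_sub hqn]; push_cast; ring
    · rw [Nat.cast_sub hge]; push_cast; ring
    · rcases hopp' with h | h
      · left; constructor <;> linarith [h.1, h.2]
      · right; constructor <;> linarith [h.1, h.2]

namespace RotSemiconj

variable {F Φ : ℝ → ℝ} {ρ : ℝ}

theorem continuous (h : RotSemiconj F Φ ρ) (hρ : Irrational ρ) (hF : Function.Surjective F) :
    Continuous Φ := by
  refine h.monotone.continuous_of_denseRange ?_
  let G : AddSubgroup ℝ :=
    { carrier := {s | ∀ x, ∃ y, Φ y = Φ x + s ∧ ∃ y', Φ y' = Φ x - s}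
      zero_mem' := fun x => ⟨x, by simp, x, by simp⟩
      add_mem' := by
        intro s t hs ht x
        obtain ⟨y, hy, -⟩ := hs x
        obtain ⟨-, -, z, hz⟩ := hs x
        obtain ⟨y', hy', -⟩ := ht y
        obtain ⟨-, -, z', hz'⟩ := ht z
        exact ⟨y', by rw [hy', hy]; ring, z', by rw [hz', hz]; ring⟩
      neg_mem' := by
        intro s hs x
        obtain ⟨y, hy, z, hz⟩ := hs x
        exact ⟨z, by rw [hz]; ring, y, by rw [hy]; ring⟩ }
  have hG : Dense (G : Set ℝ) := by
    refine dense_of_addSubgroup hρ (fun x => ⟨x + 1, h.map_add_one x, x - 1, ?_⟩)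
      (fun x => ⟨F x, h.semiconj x, ?_⟩)
    · have := h.map_add_one (x - 1)
      rw [sub_add_cancel] at this
      linarith
    · obtain ⟨y, rfl⟩ := hF x
      exact ⟨y, by rw [h.semiconj]; ring⟩
  have hd : Dense ((fun s => Φ 0 + s) '' (G : Set ℝ)) :=
    (Homeomorph.addLeft (Φ 0)).surjective.denseRange.dense_image (by fun_prop) hG
  refine hd.mono ?_
  rintro - ⟨s, hs, rfl⟩
  obtain ⟨y, hy, -⟩ := hs 0
  exact ⟨y, hy⟩

theorem exists_forall_sub_lt (h : RotSemiconj F Φ ρ) (hc : Continuous Φ) {μ : ℝ} (hμ : 0 < μ) :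
    ∃ ε > 0, ∀ x y : ℝ, x ≤ y → y - x < ε → Φ y - Φ x < μ := by
  have huc := isCompact_Icc.uniformContinuousOn_of_continuous (s := Icc (0 : ℝ) 2) hc.continuousOn
  obtain ⟨ε, hε, hεμ⟩ := Metric.uniformContinuousOn_iff.1 huc μ hμ
  refine ⟨min ε 1, lt_min hε one_pos, fun x y hxy hyx => ?_⟩
  rw [lt_min_iff] at hyx
  have h0 := Int.floor_le x
  have h1 := Int.lt_floor_add_one x
  have := hεμ (y - ⌊x⌋) ⟨by linarith, by linarith [hyx.2]⟩ (x - ⌊x⌋) ⟨by linarith, by linarith⟩ (by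
    rw [Real.dist_eq, abs_of_nonneg (by linarith)]
    linarith [hyx.1])
  rw [map_sub_int_of_map_add_one h.map_add_one, map_sub_int_of_map_add_one h.map_add_one,
    Real.dist_eq] at this
  have := (abs_lt.1 this).2
  linarith

end RotSemiconj

namespace UnicriticalLift

variable {F Φ : ℝ → ℝ} {x₀ ρ : ℝ}

theorem surjective (hF : UnicriticalLift F x₀) : Function.Surjective F :=
  surjective_of_continuous_of_map_add_one hF.contDiff.continuous hF.map_add_one

/-- A plateau of the semiconjugacy has, at arbitrarily small scales, definite space on its left. -/
theorem exists_space_of_plateau (hF : UnicriticalLift F x₀) (hΦ : RotSemiconj F Φ ρ)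
    (hρ : Irrational ρ) {a b : ℝ} (hab : a < b) (hΦab : Φ a = Φ b) :
    ∃ κ > 0, ∀ ε > 0, ∃ n : ℕ, F^[n] a - F^[n] (a - κ) < ε := by
  obtain ⟨K, hK, hcri⟩ := hF.exists_iterate_crossRatio_le hΦ
  set B := Real.exp (K * (3 : ℕ)) with hB
  have hB0 : 0 < B := Real.exp_pos _
  refine ⟨(b - a) / (4 * (B * B)), by have := sub_pos.2 hab; positivity, fun ε hε => ?_⟩
  have hmono : ∀ n : ℕ, StrictMono F^[n] := fun n => hF.strictMono.iterate n
  set l : ℕ → ℝ := fun n => F^[n] b - F^[n] a with hl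
  have hpos : ∀ n, 0 < l n := fun n => sub_pos.2 (hmono n hab)
  have hlim : Tendsto l atTop (𝓝 0) := by
    refine (summable_of_sum_range_le (c := (1 : ℕ)) (fun n => (hpos n).le)
      fun n => ?_).tendsto_atTop_zero
    obtain ⟨sep, hsep, hQ⟩ := exists_separation hρ n
    exact hΦ.sum_iterate_sub_le hF.strictMono.monotone hab.le hsep hQ le_rfl
      (by rw [hΦab]; simpa using hsep) (by rw [hΦab]; simp)
  obtain ⟨n, Q, δ, hδ0, hδ2, hQ, hnQ, hlε, ⟨m₁, k₁, hlm₁, hm₁, hm₁'⟩, ⟨m₂, k₂, hlm₂, hm₂, hm₂'⟩⟩ :=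
    exists_small_with_neighbours hρ hpos hlim hε
  obtain ⟨a', ha'⟩ := hF.surjective.iterate n (F^[n] a - l n)
  obtain ⟨d', hd'⟩ := hF.surjective.iterate n (F^[n] b + l n)
  have ha'a : a' < a := (hmono n).lt_iff_lt.1 (by rw [ha']; linarith [hpos n])
  have hbd' : b < d' := (hmono n).lt_iff_lt.1 (by rw [hd']; linarith [hpos n])
  have hΦa' : Φ a - δ ≤ Φ a' := by
    have h1 : F^[m₁] b - k₁ < F^[n] a := by
      refine hΦ.monotone.reflect_lt ?_
      rw [map_sub_int_of_map_add_one hΦ.map_add_one, hΦ.iterate, hΦ.iterate, hΦab]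
      linarith
    have h2 := hΦ.monotone (show F^[m₁] a - k₁ ≤ F^[n] a' by
      rw [ha']
      have : l n ≤ F^[m₁] b - F^[m₁] a := hlm₁
      linarith)
    rw [map_sub_int_of_map_add_one hΦ.map_add_one, hΦ.iterate, hΦ.iterate] at h2
    linarith
  have hΦd' : Φ d' ≤ Φ a + δ := by
    have h1 : F^[n] b < F^[m₂] a - k₂ := by
      refine hΦ.monotone.reflect_lt ?_
      rw [map_sub_int_of_map_add_one hΦ.map_add_one, hΦ.iterate, hΦ.iterate, hΦab]
      linarith
    have h2 := hΦ.monotone (show F^[n] d' ≤ F^[m₂] b - k₂ by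
      rw [hd']
      have : l n ≤ F^[m₂] b - F^[m₂] a := hlm₂
      linarith)
    rw [map_sub_int_of_map_add_one hΦ.map_add_one, hΦ.iterate, hΦ.iterate, ← hΦab] at h2
    linarith
  have hcr : crossRatio (F^[n] a') (F^[n] a) (F^[n] b) (F^[n] d') ≤
      B * B * crossRatio a' a b d' := by
    set m := min n Q with hm
    have hsplit : n = (n - m) + m := by omega
    have h1 := hcri 3 Q m δ a' a b d' ha'a hab hbd' hδ0 hQ (min_le_right _ _)
      (by push_cast; linarith) (by linarith)
    have h2 := hcri 3 Q (n - m) δ (F^[m] a') (F^[m] a) (F^[m] b) (F^[m] d') (hmono m ha'a)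
      (hmono m hab) (hmono m hbd') hδ0 hQ (by omega)
      (by rw [hΦ.iterate, hΦ.iterate]; push_cast; linarith)
      (by rw [hΦ.iterate, hΦ.iterate]; linarith)
    simp only [← Function.iterate_add_apply, ← hsplit] at h2
    rw [mul_assoc]
    exact h2.trans (mul_le_mul_of_nonneg_left h1 hB0.le)
  have hquarter : crossRatio (F^[n] a') (F^[n] a) (F^[n] b) (F^[n] d') = 1 / 4 := by
    have hln : F^[n] b = F^[n] a + l n := by simp [hl]
    have h4 : (F^[n] a + l n - (F^[n] a - l n)) * (F^[n] a + l n + l n - F^[n] a) =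
        4 * l n ^ 2 := by ring
    have := hpos n
    rw [ha', hd', hln, crossRatio, h4, div_eq_div_iff (by positivity) (by norm_num)]
    ring
  rw [hquarter] at hcr
  have hle := hcr.trans (mul_le_mul_of_nonneg_left (crossRatio_le_left ha'a hab hbd')
    (by positivity))
  rw [← mul_div_assoc, le_div_iff₀ (by linarith)] at hle
  refine ⟨n, ?_⟩
  have hκ : a' ≤ a - (b - a) / (4 * (B * B)) := by
    rw [le_sub_comm, div_le_iff₀ (by positivity)]
    nlinarith
  have := (hmono n).monotone hκ
  rw [ha'] at this
  linarith

/-- The semiconjugacy of a unicritical map to an irrational rotation is injective. -/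
theorem strictMono_rotSemiconj (hF : UnicriticalLift F x₀) (hΦ : RotSemiconj F Φ ρ)
    (hρ : Irrational ρ) : StrictMono Φ := by
  have hc := hΦ.continuous hρ hF.surjective
  refine hΦ.monotone.strictMono_of_injective ?_
  by_contra hinj
  obtain ⟨x, y, hxy, hΦxy⟩ : ∃ x y, x < y ∧ Φ x = Φ y := by
    simp only [Function.Injective, not_forall] at hinj
    obtain ⟨x, y, hxy, hne⟩ := hinj
    rcases lt_or_gt_of_ne hne with h | h
    exacts [⟨x, y, h, hxy⟩, ⟨y, x, h, hxy.symm⟩]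
  set S := {z | Φ z = Φ x} with hS
  have hbdd : BddBelow S := ⟨x - 1, fun z hz => by
    by_contra! hlt
    have h1 := hΦ.monotone hlt.le
    have h2 := hΦ.map_add_one (x - 1)
    rw [sub_add_cancel] at h2
    rw [hz] at h1
    linarith⟩
  have hSc : IsClosed S := isClosed_eq hc continuous_const
  have haS : sInf S ∈ S := hSc.csInf_mem ⟨x, rfl⟩ hbdd
  set a := sInf S with ha
  have hax : a ≤ x := csInf_le hbdd rfl
  obtain ⟨κ, hκ, hspace⟩ := hF.exists_space_of_plateau hΦ hρ (hax.trans_lt hxy) (haS.trans hΦxy)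
  have hμ : 0 < Φ a - Φ (a - κ) := by
    refine sub_pos.2 (lt_of_le_of_ne (hΦ.monotone (by linarith)) fun h => ?_)
    have : a ≤ a - κ := csInf_le hbdd (h.trans haS)
    linarith
  obtain ⟨ε, hε, hεμ⟩ := hΦ.exists_forall_sub_lt hc hμ
  obtain ⟨n, hn⟩ := hspace ε hε
  have := hεμ _ _ (hF.strictMono.monotone.iterate n (show a - κ ≤ a by linarith)) hn
  rw [hΦ.iterate, hΦ.iterate] at this
  linarith

end UnicriticalLift

/-! ### Failure of quasisymmetry for well approximable rotation numbers -/

/-- `ρ` is approximated by rationals better than any constant multiple of `1 / q²`. -/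
def WellApproximated (ρ : ℝ) : Prop :=
  ∀ N : ℕ, ∃ r : ℚ, |ρ - r| < 1 / ((N + 1) * (r.den : ℝ) ^ 2)

theorem separation_of_near_rat {ρ : ℝ} {r : ℚ} (h : |ρ - r| < 1 / (2 * (r.den : ℝ) ^ 2)) (j : ℕ)
    (hj0 : 0 < j) (hj : j < r.den) (k : ℤ) : 1 / (2 * (r.den : ℝ)) ≤ |j * ρ - k| := by
  have hq : (0 : ℝ) < r.den := by exact_mod_cast r.den_pos
  have hne : (j : ℤ) * r.num - k * r.den ≠ 0 := by
    intro h0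
    have hdvd : (r.den : ℤ) ∣ (j : ℤ) * r.num := ⟨k, by linarith⟩
    have hcop : IsCoprime (r.den : ℤ) r.num :=
      Int.isCoprime_iff_gcd_eq_one.2 (by
        rw [Int.gcd_comm]
        exact r.reduced)
    have := Int.le_of_dvd (by exact_mod_cast hj0) (hcop.dvd_of_dvd_mul_right hdvd)
    omega
  have h1 : (1 : ℝ) ≤ |(j : ℝ) * r.num - k * r.den| := by
    have := Int.one_le_abs hne
    exact_mod_cast this
  have hr : (r : ℝ) = r.num / r.den := Rat.cast_def r
  have h2 : 1 / (r.den : ℝ) ≤ |(j : ℝ) * r - k| := by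
    have e : (j : ℝ) * r - k = (j * r.num - k * r.den) / r.den := by
      rw [hr]; field_simp
    rw [e, abs_div, abs_of_pos hq]
    gcongr
  have h3 : |(j : ℝ) * ρ - j * r| ≤ 1 / (2 * (r.den : ℝ)) := by
    rw [← mul_sub, abs_mul, Nat.abs_cast]
    calc (j : ℝ) * |ρ - r| ≤ r.den * (1 / (2 * (r.den : ℝ) ^ 2)) :=
          mul_le_mul (by exact_mod_cast hj.le) h.le (abs_nonneg _) hq.le
      _ = 1 / (2 * (r.den : ℝ)) := by field_simp
  have h4 : |(j : ℝ) * r - k| ≤ |(j : ℝ) * ρ - j * r| + |(j : ℝ) * ρ - k| := by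
    rw [abs_sub_comm ((j : ℝ) * ρ)]
    calc |(j : ℝ) * r - k| = |((j : ℝ) * r - j * ρ) + ((j : ℝ) * ρ - k)| := by
          congr 1; ring
      _ ≤ _ := abs_add_le _ _
  have h5 : 1 / (r.den : ℝ) = 1 / (2 * (r.den : ℝ)) + 1 / (2 * (r.den : ℝ)) := by
    field_simp; norm_num
  linarith

/-- `Φ` distorts adjacent intervals of equal length `t ≤ t₀` by at most the factor `C`. -/
def SmallScaleQuasiSymm (Φ : ℝ → ℝ) (t₀ C : ℝ) : Prop :=
  ∀ x t : ℝ, 0 < t → t ≤ t₀ →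
    Φ (x + t) - Φ x ≤ C * (Φ x - Φ (x - t)) ∧ Φ x - Φ (x - t) ≤ C * (Φ (x + t) - Φ x)

theorem SmallScaleQuasiSymm.exists_le {Φ : ℝ → ℝ} {t₀ C : ℝ} (h : SmallScaleQuasiSymm Φ t₀ C)
    (hC : 0 ≤ C) (N : ℕ) :
    ∃ K : ℝ, 0 ≤ K ∧ ∀ x t : ℝ, 0 < t → t ≤ t₀ →
      Φ (x + N * t) - Φ (x - N * t) ≤ K * (Φ (x + t) - Φ x) ∧
      Φ (x + N * t) - Φ (x - N * t) ≤ K * (Φ x - Φ (x - t)) := by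
  have hone : ∃ K : ℝ, 0 ≤ K ∧ ∀ x t : ℝ, 0 < t → t ≤ t₀ →
      Φ (x + N * t) - Φ x ≤ K * (Φ (x + t) - Φ x) ∧
      Φ x - Φ (x - N * t) ≤ K * (Φ x - Φ (x - t)) := by
    induction N with
    | zero => exact ⟨0, le_rfl, fun x t _ _ => by simp⟩
    | succ N ih =>
      obtain ⟨K, hK, hN⟩ := ih
      refine ⟨K * C + 1, by positivity, fun x t ht ht₀ => ?_⟩
      have h1 := (hN (x + t) t ht ht₀).1
      have h2 := (hN (x - t) t ht ht₀).2
      have h3 := (h (x + t) t ht ht₀).1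
      have h4 := (h (x - t) t ht ht₀).2
      rw [add_sub_cancel_right] at h3
      rw [sub_add_cancel] at h4
      have e1 : x + ((N + 1 : ℕ) : ℝ) * t = x + t + N * t := by push_cast; ring
      have e2 : x - ((N + 1 : ℕ) : ℝ) * t = x - t - N * t := by push_cast; ring
      rw [e1, e2]
      have h5 := mul_le_mul_of_nonneg_left h3 hK
      have h6 := mul_le_mul_of_nonneg_left h4 hK
      constructor <;> linarith
  obtain ⟨K, hK, hN⟩ := hone
  refine ⟨K * (1 + C), by positivity, fun x t ht ht₀ => ?_⟩
  obtain ⟨h1, h2⟩ := hN x t ht ht₀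
  obtain ⟨h3, h4⟩ := h x t ht ht₀
  have h5 := mul_le_mul_of_nonneg_left h3 hK
  have h6 := mul_le_mul_of_nonneg_left h4 hK
  constructor <;> linarith

theorem exists_small_rpow_lt {A p : ℝ} (hp : 1 < p) :
    ∃ s : ℝ, 0 < s ∧ s < 1 ∧ A * s ^ p < s := by
  have hlim : Tendsto (fun s : ℝ => A * s ^ (p - 1)) (𝓝 0) (𝓝 0) := by
    have := ((Real.continuousAt_rpow_const 0 (p - 1) (Or.inr (by linarith))).tendsto).const_mul A
    rwa [Real.zero_rpow (by linarith), mul_zero] at this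
  have h1 : ∀ᶠ s in 𝓝[>] (0 : ℝ), A * s ^ (p - 1) < 1 :=
    nhdsWithin_le_nhds (hlim.eventually_lt_const one_pos)
  have h2 : ∀ᶠ s in 𝓝[>] (0 : ℝ), s ∈ Ioo (0 : ℝ) 1 := Ioo_mem_nhdsGT one_pos
  obtain ⟨s, hs1, hs0, hs2⟩ := (h1.and h2).exists
  refine ⟨s, hs0, hs2, ?_⟩
  have : s ^ p = s ^ (p - 1) * s := by
    nth_rw 3 [← Real.rpow_one s]
    rw [← Real.rpow_add hs0, sub_add_cancel]
  rw [this]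
  nlinarith

theorem le_crossRatio_of_near {y₀ y₁ y₂ y₃ x s σ : ℝ} (hs : 0 < s) (hs1 : s ≤ 1) (hσ : 0 < σ)
    (h₀ : |y₀ - x| ≤ s / 4 * σ) (h₁ : |y₁ - (x + s * σ)| ≤ s / 4 * σ)
    (h₂ : |y₂ - (x + σ)| ≤ s / 4 * σ) (h₃ : |y₃ - (x + 2 * σ)| ≤ s / 4 * σ) :
    s / 12 ≤ crossRatio y₀ y₁ y₂ y₃ := by
  rw [abs_le] at h₀ h₁ h₂ h₃
  have hsσ : 0 < s * σ := by positivity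
  have hsσ' : s * σ ≤ σ := by nlinarith
  have h10 : s * σ / 2 ≤ y₁ - y₀ := by linarith [h₁.1, h₀.2]
  have h32 : σ / 2 ≤ y₃ - y₂ := by linarith [h₃.1, h₂.2]
  have h20 : y₂ - y₀ ≤ 3 / 2 * σ := by linarith [h₂.2, h₀.1]
  have h31 : y₃ - y₁ ≤ 2 * σ := by linarith [h₃.2, h₁.1]
  have h20' : 0 < y₂ - y₀ := by linarith [h₂.1, h₀.2]
  have h31' : 0 < y₃ - y₁ := by linarith [h₃.1, h₁.2]
  rw [crossRatio, le_div_iff₀ (by positivity)]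
  calc s / 12 * ((y₂ - y₀) * (y₃ - y₁)) ≤ s / 12 * ((3 / 2 * σ) * (2 * σ)) := by gcongr
    _ = s * σ / 2 * (σ / 2) := by ring
    _ ≤ (y₁ - y₀) * (y₃ - y₂) := mul_le_mul h10 h32 (by positivity) (by linarith)

set_option maxHeartbeats 800000 in
theorem UnicriticalLift.not_smallScaleQuasiSymm {F Φ : ℝ → ℝ} {x₀ ρ t₀ C : ℝ}
    (hF : UnicriticalLift F x₀) (hΦ : RotSemiconj F Φ ρ) (hρ : Irrational ρ)
    (hwa : WellApproximated ρ) (ht₀ : 0 < t₀) (hC : 0 ≤ C) : ¬ SmallScaleQuasiSymm Φ t₀ C := by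
  intro hqs
  have hstrict := hF.strictMono_rotSemiconj hΦ hρ
  have hsurj := surjective_of_continuous_of_map_add_one (hΦ.continuous hρ hF.surjective)
    hΦ.map_add_one
  obtain ⟨K, hK, hcri⟩ := hF.exists_iterate_crossRatio_le hΦ
  obtain ⟨A, r₀, p, hA, hr₀, hp, hpow⟩ := hF.exists_map_sub_le_rpow
  set B := Real.exp (K * (1 : ℕ)) with hB
  have hB0 : 0 < B := Real.exp_pos _
  obtain ⟨s, hs, hs1', hsp⟩ := exists_small_rpow_lt (A := 12 * B * A) hp
  have hs1 := hs1'.le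
  obtain ⟨N, hN⟩ := exists_nat_ge (2 / (s / 4))
  rw [div_le_iff₀ (by positivity)] at hN
  obtain ⟨L, hL, hqsN⟩ := hqs.exists_le hC N
  set σ₀ := min r₀ t₀ with hσ₀
  have hσ₀0 : 0 < σ₀ := lt_min hr₀ ht₀
  have hμ : 0 < Φ (x₀ + 2 * σ₀) - Φ x₀ := sub_pos.2 (hstrict (by linarith))
  obtain ⟨N', hN'⟩ := exists_nat_gt
    ((L + 1) / min (Φ (x₀ + 2 * σ₀) - Φ x₀) (1 / 2))
  have hμ' : 0 < min (Φ (x₀ + 2 * σ₀) - Φ x₀) (1 / 2) := lt_min hμ (by norm_num)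
  rw [div_lt_iff₀ hμ'] at hN'
  obtain ⟨r, hr⟩ := hwa N'
  set q := r.den with hqdef
  have hq1 : 1 ≤ q := r.den_pos
  have hq : (1 : ℝ) ≤ q := by exact_mod_cast hq1
  have hN'2 : (2 : ℝ) ≤ N' := by
    have : min (Φ (x₀ + 2 * σ₀) - Φ x₀) (1 / 2) ≤ 1 / 2 := min_le_right _ _
    have : (N' : ℝ) * min (Φ (x₀ + 2 * σ₀) - Φ x₀) (1 / 2) ≤ N' * (1 / 2) := by gcongr
    linarith
  have hsep := separation_of_near_rat (ρ := ρ) (r := r) (hr.trans_le (by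
    refine one_div_le_one_div_of_le (by positivity) ?_
    gcongr
    linarith))
  set δ := |q * ρ - r.num| with hδ
  have hδ0 : 0 < δ := abs_pos.2 ((hρ.natCast_mul (by omega)).sub_intCast _).ne_zero
  have hδq : (N' + 1) * (q * δ) < 1 := by
    have e : δ = q * |ρ - r| := by
      rw [hδ, ← Nat.abs_cast q, ← abs_mul, Nat.abs_cast, mul_sub, Rat.cast_def r, ← hqdef,
        mul_div_cancel₀ _ (by positivity)]
    rw [lt_div_iff₀ (by positivity)] at hr
    rw [e]
    linarith
  have hsmall : (L + 1) * (q * δ) < min (Φ (x₀ + 2 * σ₀) - Φ x₀) (1 / 2) := by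
    have hqδ : 0 < q * δ := by positivity
    calc (L + 1) * (q * δ)
        ≤ (N' * min (Φ (x₀ + 2 * σ₀) - Φ x₀) (1 / 2)) * (q * δ) := by gcongr
      _ ≤ ((N' + 1) * (q * δ)) * min (Φ (x₀ + 2 * σ₀) - Φ x₀) (1 / 2) := by
          nlinarith [mul_pos hqδ hμ']
      _ < 1 * min (Φ (x₀ + 2 * σ₀) - Φ x₀) (1 / 2) := by gcongr
      _ = _ := one_mul _
  rw [lt_min_iff] at hsmall
  have hLδ : 0 < (L + 1) * δ := by positivity
  have hLδq : (L + 1) * δ ≤ (L + 1) * (q * δ) := by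
    gcongr
    nlinarith
  obtain ⟨z, hz⟩ := hsurj (Φ x₀ + (L + 1) * δ)
  obtain ⟨σ, rfl⟩ : ∃ σ, z = x₀ + 2 * σ := ⟨(z - x₀) / 2, by ring⟩
  have hσ : 0 < σ := by
    have : x₀ < x₀ + 2 * σ := hstrict.lt_iff_lt.1 (by rw [hz]; linarith)
    linarith
  have hσσ₀ : σ ≤ σ₀ := by
    have : x₀ + 2 * σ < x₀ + 2 * σ₀ := hstrict.lt_iff_lt.1 (by rw [hz]; linarith [hsmall.1])
    linarith
  have hσr : σ ≤ r₀ := hσσ₀.trans (min_le_left _ _)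
  have hσt : σ ≤ t₀ := hσσ₀.trans (min_le_right _ _)
  have ht : 0 < s / 4 * σ := by positivity
  have htt₀ : s / 4 * σ ≤ t₀ := by nlinarith
  have hNt : 2 * σ ≤ N * (s / 4 * σ) := by nlinarith
  have hdisp : ∀ x, x₀ ≤ x → x ≤ x₀ + 2 * σ → |F^[q] x - r.num - x| ≤ s / 4 * σ := by
    intro x hx hx'
    have hwide : (L + 1) * δ ≤ Φ (x + N * (s / 4 * σ)) - Φ (x - N * (s / 4 * σ)) := by
      have h1 := hΦ.monotone (show x₀ + 2 * σ ≤ x + N * (s / 4 * σ) by linarith)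
      have h2 := hΦ.monotone (show x - N * (s / 4 * σ) ≤ x₀ by linarith)
      linarith
    have hval : Φ (F^[q] x - r.num) = Φ x + (q * ρ - r.num) := by
      rw [map_sub_int_of_map_add_one hΦ.map_add_one, hΦ.iterate]
      ring
    have hδle := abs_le.1 hδ.ge
    obtain ⟨h1, h2⟩ := hqsN x _ ht htt₀
    rw [abs_le]
    constructor
    · by_contra! hlt
      have h3 := hΦ.monotone (show F^[q] x - r.num ≤ x - s / 4 * σ by linarith)
      rw [hval] at h3
      have : L * (Φ x - Φ (x - s / 4 * σ)) ≤ L * δ := by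
        gcongr
        linarith [hδle.1]
      linarith
    · by_contra! hlt
      have h3 := hΦ.monotone (show x + s / 4 * σ ≤ F^[q] x - r.num by linarith)
      rw [hval] at h3
      have : L * (Φ (x + s / 4 * σ) - Φ x) ≤ L * δ := by
        gcongr
        linarith [hδle.2]
      linarith
  have hsσ0 : 0 < s * σ := by positivity
  have hsσ1 : s * σ < σ := by nlinarith
  have hm01 : F x₀ < F (x₀ + s * σ) := hF.strictMono (by linarith)
  have hm12 : F (x₀ + s * σ) < F (x₀ + σ) := hF.strictMono (by linarith)
  have hm23 : F (x₀ + σ) < F (x₀ + 2 * σ) := hF.strictMono (by linarith)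
  have hit : ∀ x, F^[q - 1] (F x) = F^[q] x := fun x => by
    rw [← Function.iterate_succ_apply, Nat.succ_eq_add_one, Nat.sub_add_cancel hq1]
  have hΦlen : Φ (F (x₀ + 2 * σ)) - Φ (F x₀) = (L + 1) * δ := by
    rw [hΦ.semiconj, hΦ.semiconj, hz]
    ring
  have hcr := hcri 1 q (q - 1) (1 / (2 * (q : ℝ))) _ _ _ _ hm01 hm12 hm23 (by positivity) hsep
    (Nat.sub_le _ _)
    (by
      rw [hΦlen, Nat.cast_one, one_mul, lt_div_iff₀ (by positivity)]
      linarith [hsmall.2])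
    (by rw [hΦlen]; linarith [hsmall.2])
  simp only [hit] at hcr
  have hlow : s / 12 ≤ crossRatio (F^[q] x₀) (F^[q] (x₀ + s * σ)) (F^[q] (x₀ + σ))
      (F^[q] (x₀ + 2 * σ)) := by
    rw [← crossRatio_add_const _ _ _ _ (-(r.num : ℝ))]
    simp only [← sub_eq_add_neg]
    exact le_crossRatio_of_near hs hs1 hσ (hdisp _ le_rfl (by linarith))
      (hdisp _ (by linarith) (by linarith)) (hdisp _ (by linarith) (by linarith))
      (hdisp _ (by linarith) le_rfl)
  have hup : crossRatio (F x₀) (F (x₀ + s * σ)) (F (x₀ + σ)) (F (x₀ + 2 * σ)) ≤ A * s ^ p := by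
    refine (crossRatio_le_left hm01 hm12 hm23).trans ?_
    rw [div_le_iff₀ (by linarith)]
    exact hpow σ s hσ hσr hs hs1
  have : s / 12 ≤ B * (A * s ^ p) := hlow.trans (hcr.trans (mul_le_mul_of_nonneg_left hup hB0.le))
  linarith

/-! ### Quasisymmetric translations -/

theorem integral_translate_sub_eq {Ψ : ℝ → ℝ} (hΨ : Continuous Ψ) (θ A β₁ β₂ : ℝ) :
    ∫ β in β₁..β₂, (Ψ (θ + A + β) - Ψ (θ + β)) =
      ∫ u in (0 : ℝ)..A, (Ψ (θ + β₂ + u) - Ψ (θ + β₁ + u)) := by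
  have hintegrable : ∀ a b : ℝ, IntervalIntegrable Ψ volume a b := fun a b => hΨ.intervalIntegrable a b
  have hP : ∀ a b : ℝ, ∫ x in a..b, Ψ x = (∫ x in (0 : ℝ)..b, Ψ x) - ∫ x in (0 : ℝ)..a, Ψ x :=
    fun a b => (intervalIntegral.integral_interval_sub_left (hintegrable 0 b) (hintegrable 0 a)).symm
  have hcomp : ∀ c a b : ℝ, IntervalIntegrable (fun x => Ψ (c + x)) volume a b := fun c a b =>
    (hΨ.comp (continuous_const.add continuous_id)).intervalIntegrable a b
  rw [intervalIntegral.integral_sub (hcomp _ _ _) (hcomp _ _ _),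
    intervalIntegral.integral_sub (hcomp _ _ _) (hcomp _ _ _)]
  simp only [intervalIntegral.integral_comp_add_left]
  rw [hP (θ + A + β₁), hP (θ + β₁), hP (θ + β₂ + 0), hP (θ + β₁ + 0), add_zero, add_zero,
    add_right_comm θ A β₂, add_right_comm θ A β₁]
  ring

/-- The `M`-quasisymmetry inequalities for a map of the line. -/
def QuasiSymmWith (M : ℝ) (H : ℝ → ℝ) : Prop :=
  ∀ x t : ℝ, 0 < t →
    H (x + t) - H x ≤ M * (H x - H (x - t)) ∧ H x - H (x - t) ≤ M * (H (x + t) - H x)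

/-- If a whole interval of rotations is, in the coordinate `Φ`, uniformly quasisymmetric, then `Φ`
is quasisymmetric. -/
theorem exists_smallScaleQuasiSymm {Φ Ψ : ℝ → ℝ} (hΦ : Monotone Φ) (hΨ : StrictMono Ψ)
    (hΨc : Continuous Ψ) (hΨ1 : ∀ θ, Ψ (θ + 1) = Ψ θ + 1) {M β₁ β₂ : ℝ} (hM : 0 ≤ M)
    (hβ : β₁ < β₂)
    (h : ∀ β ∈ Icc β₁ β₂, QuasiSymmWith M fun x => Ψ (Φ x + β)) :
    ∃ C : ℝ, 0 ≤ C ∧ SmallScaleQuasiSymm Φ 1 C := by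
  set g : ℝ → ℝ := fun θ => Ψ (θ + β₂) - Ψ (θ + β₁) with hg
  have hgc : Continuous g := by fun_prop
  have hgp : Function.Periodic g 1 := fun θ => by
    simp only [hg, add_right_comm θ 1, hΨ1]
    ring
  obtain ⟨θ₁, hθ₁⟩ := hgp.exists_forall_le_of_continuous hgc
  obtain ⟨θ₂, hθ₂⟩ := Function.Periodic.exists_forall_le_of_continuous (h := fun θ => -g θ)
    (fun θ => by simp only [hgp θ]) hgc.neg
  have hκ : 0 < g θ₁ := sub_pos.2 (hΨ (by linarith))
  have hκ' : 0 < g θ₂ := sub_pos.2 (hΨ (by linarith))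
  set I : ℝ → ℝ → ℝ := fun θ A => ∫ β in β₁..β₂, (Ψ (θ + A + β) - Ψ (θ + β)) with hI
  have hIeq : ∀ θ A, I θ A = ∫ u in (0 : ℝ)..A, g (θ + u) := fun θ A => by
    simp only [hI, hg, integral_translate_sub_eq hΨc, add_right_comm θ]
  have hgi : ∀ θ A, IntervalIntegrable (fun u => g (θ + u)) volume 0 A := fun θ A =>
    (hgc.comp (continuous_const.add continuous_id)).intervalIntegrable _ _
  have hIlow : ∀ θ A, 0 ≤ A → g θ₁ * A ≤ I θ A := fun θ A hA => by
    have := intervalIntegral.integral_mono_on hA (intervalIntegrable_const (c := g θ₁)) (hgi θ A)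
      fun u _ => hθ₁ _
    rw [hIeq]
    simpa [mul_comm] using this
  have hIup : ∀ θ A, 0 ≤ A → I θ A ≤ g θ₂ * A := fun θ A hA => by
    have := intervalIntegral.integral_mono_on hA (hgi θ A) (intervalIntegrable_const (c := g θ₂))
      fun u _ => neg_le_neg_iff.1 (hθ₂ _)
    rw [hIeq]
    simpa [mul_comm] using this
  have hci : ∀ θ A, IntervalIntegrable (fun β => Ψ (θ + A + β) - Ψ (θ + β)) volume β₁ β₂ :=
    fun θ A => Continuous.intervalIntegrable (by fun_prop) _ _
  have hIM : ∀ θ A θ' A', (∀ β ∈ Icc β₁ β₂,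
      Ψ (θ + A + β) - Ψ (θ + β) ≤ M * (Ψ (θ' + A' + β) - Ψ (θ' + β))) → I θ A ≤ M * I θ' A' := by
    intro θ A θ' A' hle
    have := intervalIntegral.integral_mono_on hβ.le (hci θ A) ((hci θ' A').const_mul M) hle
    rwa [intervalIntegral.integral_const_mul] at this
  have key : ∀ θ A θ' A', 0 ≤ A → 0 ≤ A' → (∀ β ∈ Icc β₁ β₂,
      Ψ (θ + A + β) - Ψ (θ + β) ≤ M * (Ψ (θ' + A' + β) - Ψ (θ' + β))) →
      A ≤ M * g θ₂ / g θ₁ * A' := by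
    intro θ A θ' A' hA hA' hle
    rw [div_mul_eq_mul_div, le_div_iff₀ hκ, mul_comm A, mul_assoc]
    exact (hIlow θ A hA).trans ((hIM θ A θ' A' hle).trans
      (mul_le_mul_of_nonneg_left (hIup θ' A' hA') hM))
  refine ⟨M * g θ₂ / g θ₁, by positivity, fun x t ht _ => ⟨?_, ?_⟩⟩
  · refine key (Φ x) _ (Φ (x - t)) _ (sub_nonneg.2 (hΦ (by linarith)))
      (sub_nonneg.2 (hΦ (by linarith))) fun β hβ => ?_
    rw [add_sub_cancel, add_sub_cancel]
    exact (h β hβ x t ht).1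
  · refine key (Φ (x - t)) _ (Φ x) _ (sub_nonneg.2 (hΦ (by linarith)))
      (sub_nonneg.2 (hΦ (by linarith))) fun β hβ => ?_
    rw [add_sub_cancel, add_sub_cancel]
    exact (h β hβ x t ht).2

/-! ### The centralizer -/

theorem Continuous.eq_of_forall_exists_int {g : ℝ → ℝ} (hg : Continuous g)
    (h : ∀ x, ∃ k : ℤ, g x = k) (x y : ℝ) : g x = g y := by
  choose k hk using h
  have hkc : Continuous k := by
    rw [Int.isClosedEmbedding_coe_real.isInducing.continuous_iff]
    exact hg.congr hk
  rw [hk, hk, PreconnectedSpace.constant inferInstance hkc]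

/-- A degree-one homeomorphism of the line commuting with `F` up to integers is a translation in the
coordinate which linearizes `F`. -/
theorem exists_eq_translate_of_commute {F Φ Ψ H : ℝ → ℝ} {ρ : ℝ} (hρ : Irrational ρ)
    (hΦ : RotSemiconj F Φ ρ) (hFc : Continuous F) (hΦc : Continuous Φ) (hΨc : Continuous Ψ)
    (hHc : Continuous H) (hΨΦ : Function.LeftInverse Ψ Φ) (hΦΨ : Function.RightInverse Ψ Φ)
    (hH : ∀ x, H (x + 1) = H x + 1) (hcomm : ∀ x, ∃ k : ℤ, H (F x) - F (H x) = k) :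
    ∃ β, ∀ x, H x = Ψ (Φ x + β) := by
  obtain ⟨k, hk⟩ := hcomm 0
  have hk' : ∀ x, H (F x) = F (H x) + k := fun x => by
    have := Continuous.eq_of_forall_exists_int (g := fun x => H (F x) - F (H x)) (by fun_prop)
      hcomm x 0
    linarith
  set D : ℝ → ℝ := fun t => Φ (H (Ψ t)) - t with hD
  have hDc : Continuous D := by fun_prop
  have hΨ1 : ∀ t, Ψ (t + 1) = Ψ t + 1 := fun t => by
    rw [← hΨΦ (Ψ t + 1), hΦ.map_add_one, hΦΨ]
  have hΨρ : ∀ t, Ψ (t + ρ) = F (Ψ t) := fun t => by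
    rw [← hΨΦ (F (Ψ t)), hΦ.semiconj, hΦΨ]
  have hD1 : Function.Periodic D 1 := fun t => by
    simp only [hD, hΨ1, hH, hΦ.map_add_one]
    ring
  have hDρ : ∀ t, D (t + ρ) = D t + k := fun t => by
    simp only [hD, hΨρ, hk', hΦ.map_add_int, hΦ.semiconj]
    ring
  have hk0 : (k : ℝ) = 0 := by
    obtain ⟨t₁, ht₁⟩ := hD1.exists_forall_le_of_continuous hDc
    have h1 := ht₁ (t₁ + ρ)
    have h2 := ht₁ (t₁ - ρ)
    have h3 := hDρ (t₁ - ρ)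
    rw [hDρ] at h1
    rw [sub_add_cancel] at h3
    linarith
  let G : AddSubgroup ℝ :=
    { carrier := {s | ∀ t, D (t + s) = D t}
      zero_mem' := fun t => by rw [add_zero]
      add_mem' := fun {s s'} hs hs' t => by rw [← add_assoc, hs', hs]
      neg_mem' := fun {s} hs t => by
        have := hs (t + -s)
        rw [neg_add_cancel_right] at this
        exact this.symm }
  have hG : Dense (G : Set ℝ) := dense_of_addSubgroup hρ hD1 fun t => by rw [hDρ, hk0, add_zero]
  have hconst : ∀ s, D s = D 0 := by
    have hcl : IsClosed {s | D s = D 0} := isClosed_eq hDc continuous_const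
    have hsub : (G : Set ℝ) ⊆ {s | D s = D 0} := fun s hs => by
      have := hs 0
      rwa [zero_add] at this
    intro s
    have : s ∈ closure (G : Set ℝ) := hG s
    exact closure_minimal hsub hcl this
  refine ⟨D 0, fun x => ?_⟩
  have h1 : Φ (H x) - Φ x = D 0 := by
    have := hconst (Φ x)
    simp only [hD] at this ⊢
    rwa [hΨΦ] at this
  rw [← hΨΦ (H x)]
  congr 1
  linarith

/-! ### Almost every number is well approximated -/

theorem ae_irrational : ∀ᵐ ξ : ℝ, Irrational ξ := by
  have : volume (range ((↑) : ℚ → ℝ)) = 0 := (countable_range _).measure_zero _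
  filter_upwards [measure_eq_zero_iff_ae_notMem.1 this] with ξ hξ using hξ

theorem frequently_exists_rat_near {ξ : ℝ} (hξ : Irrational ξ) :
    ∃ᶠ q : ℕ in atTop, ∃ r : ℚ, r.den = q ∧ |ξ - r| < 1 / (q : ℝ) ^ 2 := by
  rw [frequently_atTop]
  intro q₀
  by_contra! hno
  refine Real.infinite_rat_abs_sub_lt_one_div_den_sq_of_irrational hξ ?_
  obtain ⟨A, hA⟩ := exists_nat_ge ((|ξ| + 1) * q₀)
  have hfin : (Icc (-(A : ℤ)) A ×ˢ Iio q₀ : Set (ℤ × ℕ)).Finite :=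
    (finite_Icc _ _).prod (finite_Iio _)
  refine Set.Finite.of_injOn (f := fun r : ℚ => (r.num, r.den)) (fun r hr => ?_)
    (fun r _ r' _ h => ?_) hfin
  · have hden : r.den < q₀ := by
      by_contra! h
      exact absurd hr (not_lt.2 (hno r.den h r rfl))
    have hd1 : (1 : ℝ) ≤ r.den := by exact_mod_cast r.den_pos
    have hr1 : |ξ - r| < 1 := by
      refine lt_of_lt_of_le hr ?_
      rw [div_le_one (by positivity)]
      exact one_le_pow₀ hd1
    have hrabs : |(r : ℝ)| ≤ |ξ| + 1 := by
      have := abs_sub_abs_le_abs_sub (r : ℝ) ξ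
      rw [abs_sub_comm] at this
      linarith
    have hnum : |(r.num : ℝ)| ≤ A := by
      have e : (r.num : ℝ) = r * r.den := by
        rw [Rat.cast_def r, div_mul_cancel₀ _ (by positivity)]
      rw [e, abs_mul, Nat.abs_cast]
      refine le_trans (mul_le_mul hrabs ?_ (by positivity) (by positivity)) hA
      exact_mod_cast hden.le
    refine ⟨?_, hden⟩
    have : |r.num| ≤ A := by exact_mod_cast hnum
    exact abs_le.1 this
  · exact Rat.ext (congrArg Prod.fst h) (congrArg Prod.snd h)

theorem ae_wellApproximated : ∀ᵐ ξ : ℝ, WellApproximated ξ := by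
  rw [show (∀ᵐ ξ : ℝ, WellApproximated ξ) ↔ ∀ N : ℕ, ∀ᵐ ξ : ℝ, ∃ r : ℚ,
    |ξ - r| < 1 / ((N + 1) * (r.den : ℝ) ^ 2) from ae_all_iff]
  intro N
  set s : ℕ → Set ℝ := fun q => {x | ∃ r : ℚ, r.den = q ∧ x = r} with hs
  have hlim : Tendsto (fun q : ℕ => 1 / (q : ℝ) ^ 2) atTop (𝓝 0) :=
    tendsto_const_div_pow 1 2 two_ne_zero
  have hM : (0 : ℝ) < 1 / (N + 2) := by positivity
  have h := blimsup_cthickening_mul_ae_eq volume (fun _ => True) s hM _ hlim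
  rw [blimsup_true, blimsup_true] at h
  filter_upwards [h.mem_iff, ae_irrational] with ξ hξ hirr
  have hmem : ξ ∈ limsup (fun q : ℕ => Metric.cthickening (1 / (q : ℝ) ^ 2) (s q)) atTop := by
    rw [mem_limsup_iff_frequently_mem]
    refine (frequently_exists_rat_near hirr).mono ?_
    rintro q ⟨r, hrq, hr⟩
    exact Metric.mem_cthickening_of_dist_le ξ r _ _ ⟨r, hrq, rfl⟩ (by rw [Real.dist_eq]; exact hr.le)
  have hmem' := hξ.2 hmem
  rw [mem_limsup_iff_frequently_mem] at hmem'
  obtain ⟨q, hq, hq0⟩ := (hmem'.and_eventually (eventually_gt_atTop 0)).exists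
  have hq0' : (0 : ℝ) < q := by exact_mod_cast hq0
  have hlt : 1 / (N + 2 : ℝ) * (1 / (q : ℝ) ^ 2) < 1 / ((N + 1) * (q : ℝ) ^ 2) := by
    rw [one_div_mul_one_div]
    refine one_div_lt_one_div_of_lt (by positivity) ?_
    gcongr
    norm_num
  have := Metric.cthickening_subset_thickening' (by positivity) hlt _ hq
  obtain ⟨-, ⟨r, rfl, rfl⟩, hr⟩ := Metric.mem_thickening_iff.1 this
  exact ⟨r, by rwa [Real.dist_eq] at hr⟩

/-! ### Meagre equivalence classes -/

theorem exists_int_sub_eq_of_coe_eq {a b : ℝ} (h : (a : S1) = (b : S1)) : ∃ k : ℤ, a - b = k := by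
  rw [← sub_eq_zero, ← AddCircle.coe_sub, AddCircle.coe_eq_zero_iff] at h
  obtain ⟨k, hk⟩ := h
  exact ⟨k, by rw [← hk]; simp⟩

theorem IsLift.continuous {f : S1 → S1} {F : ℝ → ℝ} (h : IsLift f F) : Continuous F :=
  h.1.monotone.continuous_of_surjective h.2.1

theorem Unicritical.unicriticalLift_of_isLift {f : S1 → S1} {c : S1} (hf : Unicritical f c 3)
    {F : ℝ → ℝ} (hF : IsLift f F) : ∃ x₀, UnicriticalLift F x₀ := by
  obtain ⟨F', x₀, hF', hC, -, hcrit, hnf⟩ := hf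
  have hintegrable : ∀ x, ∃ k : ℤ, F x - F' x = k := fun x =>
    exists_int_sub_eq_of_coe_eq ((hF.2.2.2 x).symm.trans (hF'.2.2.2 x))
  have heq : F = fun x => F' x + (F 0 - F' 0) := funext fun x => by
    have := Continuous.eq_of_forall_exists_int (hF.continuous.sub hF'.continuous) hintegrable x 0
    simp only [Pi.sub_apply] at this
    linarith
  have hC3 : ContDiff ℝ 3 F' := by exact_mod_cast hC
  refine ⟨x₀, hF.1, hF.2.2.1, ?_, fun x => ?_, ?_⟩
  · rw [heq]
    exact hC3.add contDiff_const
  · rw [heq, deriv_add_const]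
    exact Set.ext_iff.1 hcrit x
  · obtain ⟨d, hd, W, hW, hx₀, φ, h1, h2, h3, h4, h5⟩ := hnf
    refine ⟨d, hd, W, hW, hx₀, φ, h1, h2, h3, h4, fun y hy => ?_⟩
    rw [heq]
    simp only [h5 y hy]
    ring

theorem QuasiSymm.exists_quasiSymmWith {h : S1 → S1} (hh : QuasiSymm h) :
    ∃ H : ℝ → ℝ, IsLift h H ∧ ∃ M : ℕ, QuasiSymmWith M H := by
  obtain ⟨H, hH, M, hM, hqs⟩ := hh
  obtain ⟨n, hn⟩ := exists_nat_ge M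
  refine ⟨H, hH, n, fun x t ht => ?_⟩
  obtain ⟨h1, h2⟩ := hqs x t ht
  have hl : 0 < H x - H (x - t) := sub_pos.2 (hH.1 (by linarith))
  have hr : 0 < H (x + t) - H x := sub_pos.2 (hH.1 (by linarith))
  rw [div_le_iff₀ hl] at h2
  rw [div_le_div_iff₀ (by linarith) hl, one_mul] at h1
  constructor
  · exact h2.trans (mul_le_mul_of_nonneg_right hn hl.le)
  · rw [mul_comm] at h1
    exact h1.trans (mul_le_mul_of_nonneg_right hn hr.le)

theorem quasiSymm_id : QuasiSymm id := by
  refine ⟨id, ⟨strictMono_id, Function.surjective_id, fun _ => rfl, fun _ => rfl⟩, 2, one_lt_two,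
    fun x t ht => ?_⟩
  have : (id (x + t) - id x) / (id x - id (x - t)) = 1 := by
    simp only [id, add_sub_cancel_left, sub_sub_cancel]
    exact div_self ht.ne'
  rw [this]
  norm_num

theorem isClosed_setOf_quasiSymmWith_translate {Φ Ψ : ℝ → ℝ} (hΨ : Continuous Ψ) (M : ℝ) :
    IsClosed {β : ℝ | QuasiSymmWith M fun x => Ψ (Φ x + β)} := by
  simp only [QuasiSymmWith, ofPred_forall, ofPred_and]
  refine isClosed_iInter fun x => isClosed_iInter fun t => isClosed_iInter fun _ =>
    IsClosed.inter ?_ ?_ <;> exact isClosed_le (by fun_prop) (by fun_prop)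

/-- A closed `1`-periodic subset of the line without interior projects to a nowhere dense set. -/
theorem isNowhereDense_image_coe {A : Set ℝ} (hA : IsClosed A)
    (hper : ∀ x ∈ A, ∀ k : ℤ, x + k ∈ A) (hintegrable : interior A = ∅) :
    IsNowhereDense (((↑) : ℝ → S1) '' A) := by
  have hpre : ((↑) : ℝ → S1) ⁻¹' (((↑) : ℝ → S1) '' A) = A := by
    refine Subset.antisymm ?_ (subset_preimage_image _ _)
    rintro x ⟨y, hy, hyx⟩
    obtain ⟨k, hk⟩ := exists_int_sub_eq_of_coe_eq hyx.symm
    have := hper y hy k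
    rwa [← hk, add_sub_cancel] at this
  have hq : IsOpenQuotientMap ((↑) : ℝ → S1) := QuotientAddGroup.isOpenQuotientMap_mk
  have hcl : IsClosed (((↑) : ℝ → S1) '' A) := by
    rw [← hq.isQuotientMap.isClosed_preimage, hpre]
    exact hA
  rw [hcl.isNowhereDense_iff]
  refine hq.surjective.preimage_injective ?_
  rw [hq.isOpenMap.preimage_interior_eq_interior_preimage hq.continuous, hpre, hintegrable,
    preimage_empty]

theorem UnicriticalLift.isMeagre_class {f : S1 → S1} {F : ℝ → ℝ} {x₀ ρ : ℝ}
    (hF : UnicriticalLift F x₀) (hlift : IsLift f F) (hρ : Irrational ρ) (hwa : WellApproximated ρ)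
    (hlim : Tendsto (fun n : ℕ => F^[n] 0 / (n : ℝ)) atTop (𝓝 ρ)) (x : S1) :
    IsMeagre {y : S1 | ∃ h : S1 → S1, QuasiSymm h ∧ h ∘ f = f ∘ h ∧ h x = y} := by
  obtain ⟨Φ, hΦ⟩ := exists_rotSemiconj hF.strictMono hF.surjective hF.map_add_one hlim
  have hΦc := hΦ.continuous hρ hF.surjective
  have hΦs := hF.strictMono_rotSemiconj hΦ hρ
  have hΦsurj := surjective_of_continuous_of_map_add_one hΦc hΦ.map_add_one
  let e : ℝ ≃o ℝ := hΦs.orderIsoOfSurjective Φ hΦsurj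
  set Ψ : ℝ → ℝ := fun t => e.symm t with hΨ
  have hΨΦ : Function.LeftInverse Ψ Φ := e.symm_apply_apply
  have hΦΨ : Function.RightInverse Ψ Φ := e.apply_symm_apply
  have hΨs : StrictMono Ψ := e.symm.strictMono
  have hΨc : Continuous Ψ := e.symm.continuous
  have hΨ1 : ∀ t, Ψ (t + 1) = Ψ t + 1 := fun t => by
    rw [← hΨΦ (Ψ t + 1), hΦ.map_add_one, hΦΨ]
  obtain ⟨u, rfl⟩ := QuotientAddGroup.mk_surjective x
  set G : ℕ → Set ℝ := fun M => {β | QuasiSymmWith M fun x => Ψ (Φ x + β)} with hG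
  have hGc : ∀ M, IsClosed (G M) := fun M => isClosed_setOf_quasiSymmWith_translate hΨc M
  have hGper : ∀ M, ∀ β ∈ G M, ∀ k : ℤ, β + k ∈ G M := fun M β hβ k y t ht => by
    have := hβ y t ht
    simp only [← add_assoc, map_add_int_of_map_add_one hΨ1, add_sub_add_right_eq_sub]
    exact this
  have hGint : ∀ M, interior (G M) = ∅ := fun M => by
    by_contra hne
    obtain ⟨β, hβ⟩ := nonempty_iff_ne_empty.2 hne
    obtain ⟨ε, hε, hball⟩ := Metric.isOpen_iff.1 isOpen_interior β hβ
    have hIcc : Icc (β - ε / 2) (β + ε / 2) ⊆ G M := fun b hb => by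
      refine interior_subset (hball ?_)
      rw [Metric.mem_ball, Real.dist_eq, abs_lt]
      constructor <;> linarith [hb.1, hb.2]
    obtain ⟨C, hC, hqs⟩ := exists_smallScaleQuasiSymm hΦ.monotone hΨs hΨc hΨ1
      (M := M) (Nat.cast_nonneg M) (show β - ε / 2 < β + ε / 2 by linarith) hIcc
    exact hF.not_smallScaleQuasiSymm hΦ hρ hwa one_pos hC hqs
  have hnd : ∀ M, IsNowhereDense (((↑) : ℝ → S1) '' ((fun v => Φ v - Φ u) ⁻¹' G M)) := fun M => by
    let τ : ℝ ≃ₜ ℝ := e.toHomeomorph.trans (Homeomorph.subRight (Φ u))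
    have hτ : (fun v => Φ v - Φ u) = τ := rfl
    refine isNowhereDense_image_coe ((hGc M).preimage (by fun_prop)) (fun v hv k => ?_) ?_
    · have := hGper M _ hv k
      simp only [mem_preimage, hΦ.map_add_int]
      convert this using 1
      ring
    · rw [hτ, ← τ.isOpenMap.preimage_interior_eq_interior_preimage τ.continuous,
        hGint, preimage_empty]
  refine (isMeagre_iUnion fun M => (hnd M).isMeagre).mono ?_
  rintro y ⟨h, hqs, hcomm, rfl⟩
  obtain ⟨H, hH, M, hM⟩ := hqs.exists_quasiSymmWith
  obtain ⟨β, hβ⟩ := exists_eq_translate_of_commute hρ hΦ hlift.continuous hΦc hΨc hH.continuous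
    hΨΦ hΦΨ hH.2.2.1 fun v => exists_int_sub_eq_of_coe_eq (by
      rw [← hH.2.2.2, ← hlift.2.2.2, ← hlift.2.2.2, ← hH.2.2.2]
      exact congrFun hcomm v)
  refine mem_iUnion.2 ⟨M, H u, ?_, (hH.2.2.2 u).symm⟩
  have hHβ : H = fun x => Ψ (Φ x + β) := funext hβ
  rw [mem_preimage, hβ u, hΦΨ, add_sub_cancel_left]
  rw [hHβ] at hM
  exact hM

theorem not_countable_range_of_isMeagre {X : Type*} [TopologicalSpace X] [BaireSpace X] [Nonempty X]
    {s : X → Set X} (hs : ∀ x, IsMeagre (s x)) (hmem : ∀ x, x ∈ s x) : ¬ (range s).Countable := by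
  intro hc
  have hU : IsMeagre (⋃ t ∈ range s, t) := isMeagre_biUnion hc (by rintro - ⟨x, rfl⟩; exact hs x)
  refine not_isMeagre_of_isOpen isOpen_univ univ_nonempty (hU.mono fun x _ => ?_)
  exact mem_biUnion (mem_range_self x) (hmem x)

/-- **Proposition 1.4.** There is a full-measure set `R_A ⊆ [0,1]` of irrationals such that
for every `C³` unicritical circle map `f` with `ρ(f) ∈ R_A`, every equivalence class of the
relation `x ∼_f y` (there is a quasisymmetric `h` commuting with `f` with `h x = y`) is meagre;
in particular the set of equivalence classes is uncountable. -/
theorem classesMeagre :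
    ∃ RA : Set ℝ, RA ⊆ Icc (0 : ℝ) 1 ∧ (∀ ρ ∈ RA, Irrational ρ) ∧
      volume (Icc (0 : ℝ) 1 \ RA) = 0 ∧
      ∀ (f : S1 → S1) (c : S1) (ρ : ℝ), ρ ∈ RA → Unicritical f c 3 → HasRotNum f ρ →
        (∀ x : S1,
          IsMeagre {y : S1 | ∃ h : S1 → S1, QuasiSymm h ∧ h ∘ f = f ∘ h ∧ h x = y}) ∧
        ¬ (Set.range fun x : S1 =>
            {y : S1 | ∃ h : S1 → S1, QuasiSymm h ∧ h ∘ f = f ∘ h ∧ h x = y}).Countable := by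
  refine ⟨{ρ | ρ ∈ Icc (0 : ℝ) 1 ∧ Irrational ρ ∧ WellApproximated ρ}, fun ρ h => h.1,
    fun ρ h => h.2.1, ?_, ?_⟩
  · rw [measure_eq_zero_iff_ae_notMem]
    filter_upwards [ae_irrational, ae_wellApproximated] with ρ h1 h2 h
    exact h.2 ⟨h.1, h1, h2⟩
  · rintro f c ρ ⟨-, hρ, hwa⟩ huni ⟨F, hlift, hlim⟩
    obtain ⟨x₀, hF⟩ := huni.unicriticalLift_of_isLift hlift
    have hmeagre := hF.isMeagre_class hlift hρ hwa hlim
    exact ⟨hmeagre, not_countable_range_of_isMeagre hmeagre fun x => ⟨id, quasiSymm_id, rfl, rfl⟩⟩
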